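/- arXiv:2511.06518 — 10 statements merged into one kernel-verified Lean document; each statement's English description precedes it below -/
import Mathlib

section
/- In the discrete two-level Blotto game with sum aggregator, a Nash equilibrium exists: there exist strategies γ^{1*} ∈ Δ(K^1), δ^{1*} = (δ^{1*}_{i,c})_{i,c} with δ^{1*}_{i,c} ∈ Δ(A_i^1), γ^{2*} ∈ Δ(K^2), δ^{2*} = (δ^{2*}_{i,c})_{i,c} with δ^{2*}_{i,c} ∈ Δ(A_i^2), such that for all strategies (γ^1,δ^1) of Player 1 and (γ^2,δ^2) of Player 2: U(γ^{1*},δ^{1*},γ^2,δ^2) ≤ U(γ^{1*},δ^{1*},γ^{2*},δ^{2*}) ≤ U(γ^1,δ^1,γ^{2*},δ^{2*}), where U is the sum-aggregated expected payoff, which Player 1 minimizes and Player 2 maximizes. -/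
/-- The sum-aggregated expected payoff of the discrete two-level Blotto game. -/
noncomputable def Usum (n m1 m2 : ℕ)
    (A1 A2 : Fin n → Type*) [∀ i, Fintype (A1 i)] [∀ i, Fintype (A2 i)]
    (u : (i : Fin n) → A1 i → A2 i → ℕ → ℕ → ℝ)
    (γ1 : {k : Fin n → Fin (m1 + 1) // ∑ i, (k i : ℕ) = m1} → ℝ)
    (δ1 : (i : Fin n) → Fin (m1 + 1) → A1 i → ℝ)
    (γ2 : {k : Fin n → Fin (m2 + 1) // ∑ i, (k i : ℕ) = m2} → ℝ)
    (δ2 : (i : Fin n) → Fin (m2 + 1) → A2 i → ℝ) : ℝ :=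
  ∑ i, ∑ k1 : {k : Fin n → Fin (m1 + 1) // ∑ i, (k i : ℕ) = m1},
    ∑ k2 : {k : Fin n → Fin (m2 + 1) // ∑ i, (k i : ℕ) = m2},
      γ1 k1 * γ2 k2 *
        ∑ α1 : A1 i, ∑ α2 : A2 i,
          δ1 i (k1.1 i) α1 * δ2 i (k2.1 i) α2 *
            u i α1 α2 (k1.1 i : ℕ) (k2.1 i : ℕ)

namespace Blotto

variable {K I C : Type*} [Fintype K]

/-- The probability that the assignment `k` drawn from `γ` satisfies `loc k i = c`. -/
noncomputable def marginal [DecidableEq C] (loc : K → I → C) (γ : K → ℝ) (i : I) (c : C) : ℝ :=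
  ∑ k, if loc k i = c then γ k else 0

/-- The joint probability of `c` and `a` on the battlefield `i`. -/
noncomputable def occupation [DecidableEq C] {A : I → Type*} (loc : K → I → C) (γ : K → ℝ)
    (δ : ∀ i, C → A i → ℝ) :
    ∀ i, C → A i → ℝ :=
  fun i c a => marginal loc γ i c * δ i c a

/-- The set of behavioural strategies, as pairs of an assignment lottery and
action lotteries. -/
noncomputable def strategies (K C : Type*) {I : Type*} (A : I → Type*) [Fintype K]
    [∀ i, Fintype (A i)] :
    Set ((K → ℝ) × (∀ i, C → A i → ℝ)) :=
  {p | p.1 ∈ stdSimplex ℝ K ∧ ∀ i c, p.2 i c ∈ stdSimplex ℝ (A i)}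

/-- The occupation measures realised by behavioural strategies. -/
noncomputable def occupations [DecidableEq C] (loc : K → I → C) (A : I → Type*)
    [∀ i, Fintype (A i)] :
    Set (∀ i, C → A i → ℝ) :=
  Set.image (fun p : (K → ℝ) × (∀ i, C → A i → ℝ) => occupation loc p.1 p.2) (strategies K C A)

/-- The expected payoff as a bilinear function of the occupation measures. -/
noncomputable def payoff [Fintype I] [Fintype C] {C' : Type*} [Fintype C'] {A B : I → Type*}
    [∀ i, Fintype (A i)] [∀ i, Fintype (B i)]
    (u : ∀ i, A i → B i → C → C' → ℝ) (x : ∀ i, C → A i → ℝ) (y : ∀ i, C' → B i → ℝ) : ℝ :=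
  ∑ i, ∑ c, ∑ c', ∑ a, ∑ b, x i c a * y i c' b * u i a b c c'

theorem sum_mul_comp_eq_sum_marginal_mul [Fintype C] [DecidableEq C] (loc : K → I → C) (γ : K → ℝ)
    (i : I) (h : C → ℝ) :
    ∑ k, γ k * h (loc k i) = ∑ c, marginal loc γ i c * h c := by
  simp only [marginal, Finset.sum_mul]
  rw [Finset.sum_comm]
  simp [ite_mul]

theorem isCompact_strategies {A : I → Type*} [∀ i, Fintype (A i)] :
    IsCompact (strategies K C A) := by
  have h : strategies K C A = stdSimplex ℝ K ×ˢ
      Set.univ.pi fun i => Set.univ.pi fun _ : C => stdSimplex ℝ (A i) := by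
    ext p
    simp [strategies]
  rw [h]
  exact (isCompact_stdSimplex ℝ K).prod
    (isCompact_univ_pi fun i => isCompact_univ_pi fun _ => isCompact_stdSimplex ℝ (A i))

theorem stdSimplex_nonempty (α : Type*) [Fintype α] [Nonempty α] :
    (stdSimplex ℝ α).Nonempty := by
  classical
  exact ⟨_, single_mem_stdSimplex ℝ (Classical.arbitrary α)⟩

theorem occupations_nonempty [DecidableEq C] [Nonempty K] (loc : K → I → C) {A : I → Type*}
    [∀ i, Fintype (A i)] [∀ i, Nonempty (A i)] : (occupations loc A).Nonempty := by
  obtain ⟨γ, hγ⟩ := stdSimplex_nonempty K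
  choose δ hδ using fun i => stdSimplex_nonempty (A i)
  exact ⟨_, (γ, fun i _ => δ i), ⟨hγ, fun i _ => hδ i⟩, rfl⟩

theorem isCompact_occupations [DecidableEq C] (loc : K → I → C) {A : I → Type*}
    [∀ i, Fintype (A i)] :
    IsCompact (occupations loc A) := by
  refine isCompact_strategies.image ?_
  unfold occupation marginal
  simp only [← Finset.sum_filter]
  fun_prop

/-- Occupation measures are described by linear constraints, the action lotteries being
recovered as conditional distributions. -/
theorem mem_occupations_iff [DecidableEq C] (loc : K → I → C) {A : I → Type*} [∀ i, Fintype (A i)]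
    [∀ i, Nonempty (A i)] (x : ∀ i, C → A i → ℝ) :
    x ∈ occupations loc A ↔ ∃ γ ∈ stdSimplex ℝ K,
      (∀ i c a, 0 ≤ x i c a) ∧ ∀ i c, ∑ a, x i c a = marginal loc γ i c := by
  have marginal_nonneg {γ : K → ℝ} (hγ : γ ∈ stdSimplex ℝ K) (i : I) (c : C) :
      0 ≤ marginal loc γ i c :=
    Finset.sum_nonneg fun k _ => by split_ifs <;> simp [hγ.1 k]
  constructor
  · rintro ⟨⟨γ, δ⟩, ⟨hγ, hδ⟩, rfl⟩
    refine ⟨γ, hγ, fun i c a => mul_nonneg (marginal_nonneg hγ i c) ((hδ i c).1 a),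
      fun i c => ?_⟩
    have hsum : ∑ a, δ i c a = 1 := (hδ i c).2
    simp [occupation, ← Finset.mul_sum, hsum]
  · rintro ⟨γ, hγ, hx, hsum⟩
    have hδ (i : I) (c : C) : ∃ d ∈ stdSimplex ℝ (A i), ∀ a, marginal loc γ i c * d a = x i c a := by
      rcases eq_or_ne (marginal loc γ i c) 0 with h0 | h0
      · obtain ⟨d, hd⟩ := stdSimplex_nonempty (A i)
        refine ⟨d, hd, fun a => ?_⟩
        have hzero := (Finset.sum_eq_zero_iff_of_nonneg fun a _ => hx i c a).1
          ((hsum i c).trans h0) a (Finset.mem_univ a)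
        rw [h0, zero_mul, hzero]
      · refine ⟨fun a => x i c a / marginal loc γ i c,
          ⟨fun a => div_nonneg (hx i c a) (marginal_nonneg hγ i c), ?_⟩,
          fun a => mul_div_cancel₀ _ h0⟩
        rw [← Finset.sum_div, hsum, div_self h0]
    choose δ hδ hδx using hδ
    exact ⟨(γ, δ), ⟨hγ, hδ⟩, by ext i c a; exact hδx i c a⟩

theorem convex_occupations [DecidableEq C] (loc : K → I → C) {A : I → Type*} [∀ i, Fintype (A i)]
    [∀ i, Nonempty (A i)] : Convex ℝ (occupations loc A) := by
  intro x hx y hy s t hs ht hst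
  rw [mem_occupations_iff] at hx hy ⊢
  obtain ⟨γ, hγ, hx0, hx⟩ := hx
  obtain ⟨γ', hγ', hy0, hy⟩ := hy
  refine ⟨s • γ + t • γ', convex_stdSimplex ℝ K hγ hγ' hs ht hst, fun i c a => ?_, fun i c => ?_⟩
  · exact add_nonneg (mul_nonneg hs (hx0 i c a)) (mul_nonneg ht (hy0 i c a))
  · have hmarginal : marginal loc (s • γ + t • γ') i c =
        s * marginal loc γ i c + t * marginal loc γ' i c := by
      simp only [marginal, ← Finset.sum_filter, Pi.add_apply, Pi.smul_apply, smul_eq_mul,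
        Finset.sum_add_distrib, Finset.mul_sum]
    simp [Finset.sum_add_distrib, ← Finset.mul_sum, hx, hy, hmarginal]

section Payoff

variable [Fintype I] [Fintype C] {C' : Type*} [Fintype C'] {A B : I → Type*} [∀ i, Fintype (A i)] [∀ i, Fintype (B i)]
  (u : ∀ i, A i → B i → C → C' → ℝ)

theorem isLinearMap_payoff_left (y : ∀ i, C' → B i → ℝ) :
    IsLinearMap ℝ fun x : ∀ i, C → A i → ℝ => payoff u x y where
  map_add x x' := by simp only [payoff, Pi.add_apply, add_mul, Finset.sum_add_distrib]
  map_smul s x := by simp only [payoff, Pi.smul_apply, smul_eq_mul, mul_assoc, Finset.mul_sum]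

theorem isLinearMap_payoff_right (x : ∀ i, C → A i → ℝ) :
    IsLinearMap ℝ fun y : ∀ i, C' → B i → ℝ => payoff u x y where
  map_add y y' := by simp only [payoff, Pi.add_apply, mul_add, add_mul, Finset.sum_add_distrib]
  map_smul s y := by
    simp only [payoff, Pi.smul_apply, smul_eq_mul, mul_assoc, mul_left_comm _ s, Finset.mul_sum]

theorem exists_isSaddlePointOn_payoff {K' : Type*} [Fintype K'] [DecidableEq C]
    [DecidableEq C'] [Nonempty K]
    [Nonempty K'] [∀ i, Nonempty (A i)] [∀ i, Nonempty (B i)]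
    (loc : K → I → C) (loc' : K' → I → C') :
    ∃ x ∈ occupations loc A, ∃ y ∈ occupations loc' B,
      IsSaddlePointOn (occupations loc A) (occupations loc' B) (payoff u) x y := by
  refine Sion.exists_isSaddlePointOn (occupations_nonempty loc) (convex_occupations loc)
    (isCompact_occupations loc) (fun y _ => ?_) (fun y _ => ?_) (convex_occupations loc')
    (occupations_nonempty loc') (isCompact_occupations loc') (fun x _ => ?_) (fun x _ => ?_)
  · refine Continuous.lowerSemicontinuous ?_ |>.lowerSemicontinuousOn _
    unfold payoff
    fun_prop
  · exact (((isLinearMap_payoff_left u y).mk' _).convexOn (convex_occupations loc)).quasiconvexOn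
  · refine Continuous.upperSemicontinuous ?_ |>.upperSemicontinuousOn _
    unfold payoff
    fun_prop
  · exact
      (((isLinearMap_payoff_right u x).mk' _).concaveOn (convex_occupations loc')).quasiconcaveOn

end Payoff

theorem nonempty_assignments {n : ℕ} (hn : 1 ≤ n) (m : ℕ) :
    Nonempty {k : Fin n → Fin (m + 1) // ∑ i, (k i : ℕ) = m} := by
  refine ⟨⟨Pi.single ⟨0, hn⟩ (Fin.last m), ?_⟩⟩
  rw [Finset.sum_eq_single ⟨0, hn⟩] <;> simp +contextual

theorem Usum_eq_payoff_occupation (n m1 m2 : ℕ)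
    (A1 A2 : Fin n → Type*) [∀ i, Fintype (A1 i)] [∀ i, Fintype (A2 i)]
    (u : (i : Fin n) → A1 i → A2 i → ℕ → ℕ → ℝ)
    (γ1 : {k : Fin n → Fin (m1 + 1) // ∑ i, (k i : ℕ) = m1} → ℝ)
    (δ1 : (i : Fin n) → Fin (m1 + 1) → A1 i → ℝ)
    (γ2 : {k : Fin n → Fin (m2 + 1) // ∑ i, (k i : ℕ) = m2} → ℝ)
    (δ2 : (i : Fin n) → Fin (m2 + 1) → A2 i → ℝ) :
    Usum n m1 m2 A1 A2 u γ1 δ1 γ2 δ2 =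
      payoff (fun i a b (c : Fin (m1 + 1)) (c' : Fin (m2 + 1)) => u i a b c c')
        (occupation Subtype.val γ1 δ1) (occupation Subtype.val γ2 δ2) := by
  refine Finset.sum_congr rfl fun i _ => ?_
  let g (c : Fin (m1 + 1)) (c' : Fin (m2 + 1)) : ℝ :=
    ∑ a, ∑ b, δ1 i c a * δ2 i c' b * u i a b c c'
  calc ∑ k1, ∑ k2, γ1 k1 * γ2 k2 * g (k1.1 i) (k2.1 i)
      = ∑ k1, γ1 k1 * ∑ c', marginal Subtype.val γ2 i c' * g (k1.1 i) c' := by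
        refine Finset.sum_congr rfl fun k1 _ => ?_
        simp_rw [mul_assoc]
        rw [← Finset.mul_sum, sum_mul_comp_eq_sum_marginal_mul Subtype.val γ2 i (g (k1.1 i))]
    _ = ∑ c, marginal Subtype.val γ1 i c * ∑ c', marginal Subtype.val γ2 i c' * g c c' :=
        sum_mul_comp_eq_sum_marginal_mul Subtype.val γ1 i
          fun c => ∑ c', marginal Subtype.val γ2 i c' * g c c'
    _ = _ := by
        simp only [g, occupation, Finset.mul_sum]
        refine Finset.sum_congr rfl fun c _ => Finset.sum_congr rfl fun c' _ =>
          Finset.sum_congr rfl fun a _ => Finset.sum_congr rfl fun b _ => ?_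
        ring

end Blotto

/-- the discrete two-level Blotto game with sum aggregator admits a
Nash equilibrium (Player 1 minimizes, Player 2 maximizes). -/
theorem stmt_2 (n : ℕ) (hn : 1 ≤ n) (m1 m2 : ℕ)
    (A1 A2 : Fin n → Type*) [∀ i, Fintype (A1 i)] [∀ i, Fintype (A2 i)]
    [∀ i, Nonempty (A1 i)] [∀ i, Nonempty (A2 i)]
    (u : (i : Fin n) → A1 i → A2 i → ℕ → ℕ → ℝ) :
    ∃ γ1s : {k : Fin n → Fin (m1 + 1) // ∑ i, (k i : ℕ) = m1} → ℝ,
    ∃ δ1s : (i : Fin n) → Fin (m1 + 1) → A1 i → ℝ,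
    ∃ γ2s : {k : Fin n → Fin (m2 + 1) // ∑ i, (k i : ℕ) = m2} → ℝ,
    ∃ δ2s : (i : Fin n) → Fin (m2 + 1) → A2 i → ℝ,
      γ1s ∈ stdSimplex ℝ {k : Fin n → Fin (m1 + 1) // ∑ i, (k i : ℕ) = m1} ∧
      (∀ i c, δ1s i c ∈ stdSimplex ℝ (A1 i)) ∧
      γ2s ∈ stdSimplex ℝ {k : Fin n → Fin (m2 + 1) // ∑ i, (k i : ℕ) = m2} ∧
      (∀ i c, δ2s i c ∈ stdSimplex ℝ (A2 i)) ∧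
      ∀ γ1, γ1 ∈ stdSimplex ℝ {k : Fin n → Fin (m1 + 1) // ∑ i, (k i : ℕ) = m1} →
      ∀ δ1 : (i : Fin n) → Fin (m1 + 1) → A1 i → ℝ,
        (∀ i c, δ1 i c ∈ stdSimplex ℝ (A1 i)) →
      ∀ γ2, γ2 ∈ stdSimplex ℝ {k : Fin n → Fin (m2 + 1) // ∑ i, (k i : ℕ) = m2} →
      ∀ δ2 : (i : Fin n) → Fin (m2 + 1) → A2 i → ℝ,
        (∀ i c, δ2 i c ∈ stdSimplex ℝ (A2 i)) →
        Usum n m1 m2 A1 A2 u γ1s δ1s γ2 δ2 ≤ Usum n m1 m2 A1 A2 u γ1s δ1s γ2s δ2s ∧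
        Usum n m1 m2 A1 A2 u γ1s δ1s γ2s δ2s ≤ Usum n m1 m2 A1 A2 u γ1 δ1 γ2s δ2s := by
  have := Blotto.nonempty_assignments hn m1
  have := Blotto.nonempty_assignments hn m2
  obtain ⟨_, ⟨⟨γ1s, δ1s⟩, hs1, rfl⟩, _, ⟨⟨γ2s, δ2s⟩, hs2, rfl⟩, h⟩ :=
    Blotto.exists_isSaddlePointOn_payoff
      (fun i a b (c : Fin (m1 + 1)) (c' : Fin (m2 + 1)) => u i a b c c')
      (Subtype.val : {k : Fin n → Fin (m1 + 1) // ∑ i, (k i : ℕ) = m1} → _)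
      (Subtype.val : {k : Fin n → Fin (m2 + 1) // ∑ i, (k i : ℕ) = m2} → _)
  refine ⟨γ1s, δ1s, γ2s, δ2s, hs1.1, hs1.2, hs2.1, hs2.2, fun γ1 hγ1 δ1 hδ1 γ2 hγ2 δ2 hδ2 => ?_⟩
  simp only [Blotto.Usum_eq_payoff_occupation]
  exact ⟨h _ ⟨(γ1s, δ1s), hs1, rfl⟩ _ ⟨(γ2, δ2), ⟨hγ2, hδ2⟩, rfl⟩,
    h _ ⟨(γ1, δ1), ⟨hγ1, hδ1⟩, rfl⟩ _ ⟨(γ2s, δ2s), hs2, rfl⟩⟩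
end

section
/- For the two-battlefield discrete min-aggregated Blotto game with payoff U(p,t) = min{ (Σ_{k=0}^2 p_k (k+1)) · (Σ_{ℓ=0}^2 t_ℓ/(ℓ+1)), (Σ_{k=0}^2 p_k (3−k)) · (Σ_{ℓ=0}^2 t_ℓ/(3−ℓ)) }, the max-min value of the maximizing player equals 2/3: max_{p ∈ Δ₃} min_{t ∈ Δ₃} U(p,t) = 2/3, and the maximum is attained at p = (1/2, 0, 1/2). -/
/-- The min-aggregated payoff of the two-battlefield discrete Blotto game in which
battlefield utilities are `(k¹+1)/(k²+1)` and both players have 2 soldiers. -/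
noncomputable def Ublotto (p t : Fin 3 → ℝ) : ℝ :=
  min ((∑ k : Fin 3, p k * ((k : ℕ) + 1 : ℝ)) * (∑ l : Fin 3, t l / ((l : ℕ) + 1 : ℝ)))
      ((∑ k : Fin 3, p k * (3 - (k : ℕ) : ℝ)) * (∑ l : Fin 3, t l / (3 - (l : ℕ) : ℝ)))

lemma mem_stdSimplex_fin_three {q : Fin 3 → ℝ} :
    q ∈ stdSimplex ℝ (Fin 3) ↔ (0 ≤ q 0 ∧ 0 ≤ q 1 ∧ 0 ≤ q 2) ∧ q 0 + q 1 + q 2 = 1 := by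
  simp [stdSimplex, Fin.forall_fin_succ, Fin.sum_univ_three]

lemma Ublotto_eq (p t : Fin 3 → ℝ) :
    Ublotto p t = min ((p 0 + 2 * p 1 + 3 * p 2) * (t 0 + t 1 / 2 + t 2 / 3))
      ((3 * p 0 + 2 * p 1 + p 2) * (t 0 / 3 + t 1 / 2 + t 2)) := by
  simp only [Ublotto, Fin.sum_univ_three, Fin.val_zero, Fin.val_one, Fin.val_two]
  push_cast
  congr 1 <;> ring

lemma Ublotto_nonneg {p t : Fin 3 → ℝ} (hp : p ∈ stdSimplex ℝ (Fin 3))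
    (ht : t ∈ stdSimplex ℝ (Fin 3)) : 0 ≤ Ublotto p t := by
  obtain ⟨⟨hp0, hp1, hp2⟩, -⟩ := mem_stdSimplex_fin_three.1 hp
  obtain ⟨⟨ht0, ht1, ht2⟩, -⟩ := mem_stdSimplex_fin_three.1 ht
  rw [Ublotto_eq]
  exact le_min (by positivity) (by positivity)

lemma exists_Ublotto_le_two_thirds {p : Fin 3 → ℝ} (hp : p ∈ stdSimplex ℝ (Fin 3)) :
    ∃ t ∈ stdSimplex ℝ (Fin 3), Ublotto p t ≤ 2 / 3 := by
  obtain ⟨-, hp⟩ := mem_stdSimplex_fin_three.1 hp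
  rcases le_total (p 2) (p 0) with h | h
  · refine ⟨![0, 0, 1], by simp [mem_stdSimplex_fin_three], ?_⟩
    rw [Ublotto_eq]
    refine min_le_of_left_le ?_
    simp
    linarith
  · refine ⟨![1, 0, 0], by simp [mem_stdSimplex_fin_three], ?_⟩
    rw [Ublotto_eq]
    refine min_le_of_right_le ?_
    simp
    linarith

lemma sInf_Ublotto_le_two_thirds {p : Fin 3 → ℝ} (hp : p ∈ stdSimplex ℝ (Fin 3)) :
    sInf {s : ℝ | ∃ t ∈ stdSimplex ℝ (Fin 3), s = Ublotto p t} ≤ 2 / 3 := by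
  obtain ⟨t, ht, hle⟩ := exists_Ublotto_le_two_thirds hp
  refine csInf_le_of_le ⟨0, ?_⟩ ⟨t, ht, rfl⟩ hle
  rintro _ ⟨t, ht, rfl⟩
  exact Ublotto_nonneg hp ht

lemma half_zero_half_mem_stdSimplex : (![1/2, 0, 1/2] : Fin 3 → ℝ) ∈ stdSimplex ℝ (Fin 3) := by
  rw [mem_stdSimplex_fin_three]
  simp
  norm_num

lemma two_thirds_le_Ublotto {t : Fin 3 → ℝ} (ht : t ∈ stdSimplex ℝ (Fin 3)) :
    2 / 3 ≤ Ublotto ![1/2, 0, 1/2] t := by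
  obtain ⟨⟨ht0, ht1, ht2⟩, hsum⟩ := mem_stdSimplex_fin_three.1 ht
  rw [Ublotto_eq]
  refine le_min ?_ ?_ <;> simp <;> linarith

lemma sInf_Ublotto_half_zero_half :
    sInf {s : ℝ | ∃ t ∈ stdSimplex ℝ (Fin 3), s = Ublotto ![1/2, 0, 1/2] t} = 2 / 3 := by
  refine (sInf_Ublotto_le_two_thirds half_zero_half_mem_stdSimplex).antisymm
    (le_csInf ⟨_, _, half_zero_half_mem_stdSimplex, rfl⟩ ?_)
  rintro _ ⟨t, ht, rfl⟩
  exact two_thirds_le_Ublotto ht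

/-- the max-min value of the game is `2/3`, attained at `p = (1/2, 0, 1/2)`. -/
theorem stmt_3 :
    IsGreatest {r : ℝ | ∃ p ∈ stdSimplex ℝ (Fin 3),
        r = sInf {s : ℝ | ∃ t ∈ stdSimplex ℝ (Fin 3), s = Ublotto p t}} (2/3) ∧
    (![1/2, 0, 1/2] : Fin 3 → ℝ) ∈ stdSimplex ℝ (Fin 3) ∧
    sInf {s : ℝ | ∃ t ∈ stdSimplex ℝ (Fin 3), s = Ublotto ![1/2, 0, 1/2] t} = 2/3 := by
  refine ⟨⟨⟨_, half_zero_half_mem_stdSimplex, sInf_Ublotto_half_zero_half.symm⟩, ?_⟩,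
    half_zero_half_mem_stdSimplex, sInf_Ublotto_half_zero_half⟩
  rintro _ ⟨p, hp, rfl⟩
  exact sInf_Ublotto_le_two_thirds hp
end

section
/- Let γ ∈ Δ(K²), let δ^1_i ∈ Δ(A_i^1) for each battlefield i, and let δ^2_{i,c} ∈ Δ(A_i^2) for each battlefield i and soldier count c ∈ {0,…,m²}. Define x^2_{i,c,α} := (Σ_{k ∈ K² with k_i = c} γ(k)) · δ^2_{i,c}(α). Then the min-aggregated expected payoff satisfies: min_{1≤i≤n} Σ_{k ∈ K²} γ(k) Σ_{α^1 ∈ A_i^1} Σ_{α^2 ∈ A_i^2} δ^1_i(α^1) δ^2_{i,k_i}(α^2) u_i(α^1,α^2,k_i) = min_{p ∈ Δ(n)} Σ_{i=1}^n Σ_{α^2 ∈ A_i^2} Σ_{c=0}^{m²} p_i · (Σ_{α^1 ∈ A_i^1} δ^1_i(α^1) u_i(α^1,α^2,c)) · x^2_{i,c,α^2}, where Δ(n) is the set of probability vectors on {1,…,n}. In particular the right-hand side is bilinear in p and in the collection x^2. -/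
/-- The minimum of finitely many reals is the infimum of their convex combinations. -/
theorem inf'_univ_eq_sInf_stdSimplex {ι : Type*} [Fintype ι]
    (h : (Finset.univ : Finset ι).Nonempty) (f : ι → ℝ) :
    Finset.univ.inf' h f = sInf {r : ℝ | ∃ p ∈ stdSimplex ℝ ι, r = ∑ i, p i * f i} := by
  classical
  refine (IsLeast.csInf_eq ⟨?_, ?_⟩).symm
  · obtain ⟨j, -, hj⟩ := Finset.exists_mem_eq_inf' h f
    exact ⟨Pi.single j 1, single_mem_stdSimplex ℝ j, by simp [hj, Pi.single_apply]⟩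
  · rintro _ ⟨p, ⟨hp0, hp1⟩, rfl⟩
    calc Finset.univ.inf' h f = ∑ i, p i * Finset.univ.inf' h f := by
          rw [← Finset.sum_mul, hp1, one_mul]
      _ ≤ ∑ i, p i * f i := Finset.sum_le_sum fun i hi =>
          mul_le_mul_of_nonneg_left (Finset.inf'_le f hi) (hp0 i)

/-- Integrating against the push-forward of the weights `w` along `g`. -/
theorem sum_pushforward_mul {κ β : Type*} [Fintype κ] [Fintype β] [DecidableEq β]
    (g : κ → β) (w : κ → ℝ) (F : β → ℝ) :
    ∑ c, (∑ k, if g k = c then w k else 0) * F c = ∑ k, w k * F (g k) := by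
  simp_rw [Finset.sum_mul, ite_mul, zero_mul]
  rw [Finset.sum_comm]
  simp


/-- Kuhn's theorem under one-sided min aggregator, discrete soldiers:
the min-aggregated expected payoff equals a minimum over convexification weights `p`
of an expression bilinear in `p` and the treeplex variables `x²`. -/
theorem stmt_5 (n : ℕ) (hn : 0 < n) (m : ℕ)
    (A1 A2 : Fin n → Type*) [∀ i, Fintype (A1 i)] [∀ i, Fintype (A2 i)]
    [∀ i, Nonempty (A1 i)] [∀ i, Nonempty (A2 i)]
    (u : (i : Fin n) → A1 i → A2 i → ℕ → ℝ)
    (γ : {k : Fin n → Fin (m + 1) // ∑ i, (k i : ℕ) = m} → ℝ)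
    (hγ : γ ∈ stdSimplex ℝ {k : Fin n → Fin (m + 1) // ∑ i, (k i : ℕ) = m})
    (δ1 : (i : Fin n) → A1 i → ℝ)
    (hδ1 : ∀ i, δ1 i ∈ stdSimplex ℝ (A1 i))
    (δ2 : (i : Fin n) → Fin (m + 1) → A2 i → ℝ)
    (hδ2 : ∀ i c, δ2 i c ∈ stdSimplex ℝ (A2 i))
    (x2 : (i : Fin n) → Fin (m + 1) → A2 i → ℝ)
    (hx2 : ∀ i c α, x2 i c α =
      (∑ k : {k : Fin n → Fin (m + 1) // ∑ i, (k i : ℕ) = m},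
        if k.1 i = c then γ k else 0) * δ2 i c α) :
    (Finset.univ.inf' ⟨⟨0, hn⟩, Finset.mem_univ _⟩ fun i =>
      ∑ k : {k : Fin n → Fin (m + 1) // ∑ i, (k i : ℕ) = m}, γ k *
        ∑ α1 : A1 i, ∑ α2 : A2 i,
          δ1 i α1 * δ2 i (k.1 i) α2 * u i α1 α2 (k.1 i : ℕ)) =
    sInf {r : ℝ | ∃ p ∈ stdSimplex ℝ (Fin n),
      r = ∑ i, ∑ α2 : A2 i, ∑ c : Fin (m + 1),
        p i * (∑ α1 : A1 i, δ1 i α1 * u i α1 α2 (c : ℕ)) * x2 i c α2} := by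
  refine (inf'_univ_eq_sInf_stdSimplex _ _).trans ?_
  refine congrArg sInf (Set.ext fun r => exists_congr fun p => and_congr_right fun _ =>
    Eq.congr_right (Finset.sum_congr rfl fun i _ => ?_))
  rw [← sum_pushforward_mul (fun k => k.1 i) γ
    (fun c => ∑ α1 : A1 i, ∑ α2 : A2 i, δ1 i α1 * δ2 i c α2 * u i α1 α2 (c : ℕ)),
    Finset.sum_comm, Finset.mul_sum]
  refine Finset.sum_congr rfl fun c _ => ?_
  rw [Finset.sum_comm, Finset.mul_sum, Finset.mul_sum]
  refine Finset.sum_congr rfl fun α2 _ => ?_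
  have hδ : ∑ α1 : A1 i, δ1 i α1 * δ2 i c α2 * u i α1 α2 (c : ℕ) =
      (∑ α1 : A1 i, δ1 i α1 * u i α1 α2 (c : ℕ)) * δ2 i c α2 := by
    rw [Finset.sum_mul]
    exact Finset.sum_congr rfl fun α1 _ => by ring
  rw [hx2, hδ]
  ring
end

section
/- In the one-sided discrete two-level Blotto game with min aggregator, the minimax theorem holds: min over δ^1 (with δ^1_i ∈ Δ(A_i^1) for each i) of max over (γ, δ^2) (with γ ∈ Δ(K²) and δ^2_{i,c} ∈ Δ(A_i^2) for each i, c) of U(δ^1, γ, δ^2) equals max over (γ, δ^2) of min over δ^1 of U(δ^1, γ, δ^2), where U(δ^1,γ,δ^2) := min_{1≤i≤n} Σ_{k∈K²} γ(k) Σ_{α^1∈A_i^1} Σ_{α^2∈A_i^2} δ^1_i(α^1) δ^2_{i,k_i}(α^2) u_i(α^1,α^2,k_i); all the indicated minima and maxima are attained. -/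
/-- The min-aggregated expected payoff of the one-sided discrete two-level Blotto game:
only Player 2 (the maximizer) allocates soldiers. -/
noncomputable def Uosm (n m : ℕ) (hn : 0 < n)
    (A1 A2 : Fin n → Type*) [∀ i, Fintype (A1 i)] [∀ i, Fintype (A2 i)]
    (u : (i : Fin n) → A1 i → A2 i → ℕ → ℝ)
    (δ1 : (i : Fin n) → A1 i → ℝ)
    (γ : {k : Fin n → Fin (m + 1) // ∑ i, (k i : ℕ) = m} → ℝ)
    (δ2 : (i : Fin n) → Fin (m + 1) → A2 i → ℝ) : ℝ :=
  Finset.univ.inf' ⟨⟨0, hn⟩, Finset.mem_univ _⟩ fun i =>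
    ∑ k : {k : Fin n → Fin (m + 1) // ∑ i, (k i : ℕ) = m}, γ k *
      ∑ α1 : A1 i, ∑ α2 : A2 i,
        δ1 i α1 * δ2 i (k.1 i) α2 * u i α1 α2 (k.1 i : ℕ)

/-- A nonnegative weight on a nonempty finite type is its total mass times a probability
distribution. -/
theorem exists_mem_stdSimplex_eq_sum_mul {α : Type*} [Fintype α] [Nonempty α]
    {w : α → ℝ} (hw : ∀ a, 0 ≤ w a) :
    ∃ p ∈ stdSimplex ℝ α, ∀ a, w a = (∑ b, w b) * p a := by
  classical
  by_cases h : ∑ b, w b = 0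
  · refine ⟨Pi.single (Classical.arbitrary α) 1, single_mem_stdSimplex ℝ _, fun a => ?_⟩
    rw [h, zero_mul]
    exact (Finset.sum_eq_zero_iff_of_nonneg fun b _ => hw b).1 h a (Finset.mem_univ a)
  · refine ⟨fun a => w a / ∑ b, w b,
      ⟨fun a => div_nonneg (hw a) (Finset.sum_nonneg fun b _ => hw b), ?_⟩, fun a => ?_⟩
    · rw [← Finset.sum_div, div_self h]
    · field_simp

/-- Von Neumann's minimax theorem for a bilinear form on compact convex subsets of
finite-dimensional spaces, in saddle point form. -/
theorem LinearMap.exists_isSaddlePointOn {E F : Type*}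
    [TopologicalSpace E] [AddCommGroup E] [Module ℝ E] [IsTopologicalAddGroup E]
    [ContinuousSMul ℝ E] [T2Space E] [FiniteDimensional ℝ E]
    [TopologicalSpace F] [AddCommGroup F] [Module ℝ F] [IsTopologicalAddGroup F]
    [ContinuousSMul ℝ F] [T2Space F] [FiniteDimensional ℝ F]
    (B : E →ₗ[ℝ] F →ₗ[ℝ] ℝ) {X : Set E} {Y : Set F}
    (neX : X.Nonempty) (cX : Convex ℝ X) (kX : IsCompact X)
    (neY : Y.Nonempty) (cY : Convex ℝ Y) (kY : IsCompact Y) :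
    ∃ a ∈ X, ∃ b ∈ Y, IsSaddlePointOn X Y (fun x y => B x y) a b :=
  Sion.exists_isSaddlePointOn neX cX kX
    (fun y _ => (B.flip y).continuous_of_finiteDimensional.continuousOn.lowerSemicontinuousOn)
    (fun y _ => ((B.flip y).convexOn cX).quasiconvexOn)
    cY neY kY
    (fun x _ => (B x).continuous_of_finiteDimensional.continuousOn.upperSemicontinuousOn)
    (fun x _ => ((B x).concaveOn cY).quasiconcaveOn)

section Occupation

variable {ι K C : Type*} [Fintype K] [DecidableEq C] {A : ι → Type*}

/-- The joint weight of the local state `c` and the action `a` at site `i` when the global state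
is drawn from `γ` and the action is then drawn from `δ i c`. -/
def occupation (s : ι → K → C) (γ : K → ℝ) (δ : (i : ι) → C → A i → ℝ) (i : ι) (c : C)
    (a : A i) : ℝ :=
  (∑ k, if s i k = c then γ k else 0) * δ i c a

/-- The weights `occupation s γ δ` arising from mixed and behavioral strategies. -/
def occupationSet (s : ι → K → C) (A : ι → Type*) [∀ i, Fintype (A i)] :
    Set ((i : ι) → C → A i → ℝ) :=
  {y | ∃ γ ∈ stdSimplex ℝ K, ∃ δ : (i : ι) → C → A i → ℝ,
    (∀ i c, δ i c ∈ stdSimplex ℝ (A i)) ∧ occupation s γ δ = y}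

variable [∀ i, Fintype (A i)]

theorem isCompact_occupationSet (s : ι → K → C) : IsCompact (occupationSet s A) := by
  have h : IsCompact (stdSimplex ℝ K ×ˢ Set.univ.pi fun i => Set.univ.pi fun _ : C =>
      stdSimplex ℝ (A i)) :=
    (isCompact_stdSimplex ℝ K).prod (isCompact_univ_pi fun i => isCompact_univ_pi fun _ =>
      isCompact_stdSimplex ℝ (A i))
  have hc : Continuous fun p : (K → ℝ) × ((i : ι) → C → A i → ℝ) => occupation s p.1 p.2 := by
    unfold occupation
    refine continuous_pi fun i => continuous_pi fun c => continuous_pi fun a => ?_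
    refine .mul (continuous_finsetSum _ fun k _ => ?_) (by fun_prop)
    split_ifs <;> fun_prop
  convert h.image hc
  ext y
  simp only [occupationSet, Set.mem_ofPred_eq, Set.mem_image, Set.mem_prod, Set.mem_univ_pi,
    Prod.exists]
  grind

theorem occupationSet_nonempty [Nonempty K] [∀ i, Nonempty (A i)] (s : ι → K → C) :
    (occupationSet s A).Nonempty := by
  classical
  exact ⟨_, Pi.single (Classical.arbitrary K) 1, single_mem_stdSimplex ℝ _,
    fun _ _ => Pi.single (Classical.arbitrary _) 1, fun _ _ => single_mem_stdSimplex ℝ _, rfl⟩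

theorem convex_occupationSet [∀ i, Nonempty (A i)] (s : ι → K → C) :
    Convex ℝ (occupationSet s A) := by
  rintro _ ⟨γ, hγ, δ, hδ, rfl⟩ _ ⟨γ', hγ', δ', hδ', rfl⟩ p q hp hq hpq
  have marg_nonneg {g : K → ℝ} (hg : g ∈ stdSimplex ℝ K) (i : ι) (c : C) :
      0 ≤ ∑ k, if s i k = c then g k else 0 :=
    Finset.sum_nonneg fun k _ => by split_ifs; exacts [hg.1 k, le_rfl]
  have hw (i : ι) (c : C) (a : A i) :
      0 ≤ (p • occupation s γ δ + q • occupation s γ' δ') i c a :=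
    add_nonneg (mul_nonneg hp (mul_nonneg (marg_nonneg hγ i c) ((hδ i c).1 a)))
      (mul_nonneg hq (mul_nonneg (marg_nonneg hγ' i c) ((hδ' i c).1 a)))
  choose d hd hwd using fun i c => exists_mem_stdSimplex_eq_sum_mul (hw i c)
  refine ⟨p • γ + q • γ', convex_stdSimplex ℝ K hγ hγ' hp hq hpq, d, hd, ?_⟩
  ext i c a
  rw [hwd, occupation]
  congr 1
  simp only [Pi.add_apply, Pi.smul_apply, smul_eq_mul, occupation, Finset.sum_add_distrib,
    ← Finset.mul_sum, (hδ i c).2, (hδ' i c).2, mul_one]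
  rw [Finset.mul_sum, Finset.mul_sum, ← Finset.sum_add_distrib]
  refine Finset.sum_congr rfl fun k _ => ?_
  split_ifs <;> simp

theorem sum_mul_eq_sum_occupation [Fintype C] (s : ι → K → C) (γ : K → ℝ)
    (δ : (i : ι) → C → A i → ℝ) (i : ι) (g : C → A i → ℝ) :
    ∑ k, γ k * ∑ a, δ i (s i k) a * g (s i k) a =
      ∑ c, ∑ a, occupation s γ δ i c a * g c a := by
  simp only [occupation, mul_assoc, ← Finset.mul_sum]
  simp only [Finset.sum_mul, ite_mul, zero_mul]
  rw [Finset.sum_comm]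
  simp

end Occupation

section MinAggregator

variable {ι C : Type*} [Fintype ι] [Fintype C] {A1 A2 : ι → Type*}
  [∀ i, Fintype (A1 i)] [∀ i, Fintype (A2 i)]

/-- The payoff when Player 1 draws a battlefield together with an action on it from `x` and
Player 2's weights are `y`. -/
noncomputable def sigmaPayoff (g : (i : ι) → A1 i → A2 i → C → ℝ) :
    ((Σ i, A1 i) → ℝ) →ₗ[ℝ] ((i : ι) → C → A2 i → ℝ) →ₗ[ℝ] ℝ :=
  LinearMap.mk₂ ℝ (fun x y => ∑ p, x p * ∑ c, ∑ b, y p.1 c b * g p.1 p.2 b c)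
    (fun x x' y => by simp [add_mul, Finset.sum_add_distrib])
    (fun r x y => by simp [Finset.mul_sum, mul_assoc])
    (fun x y y' => by simp [add_mul, mul_add, Finset.sum_add_distrib])
    (fun r x y => by
      simp only [Pi.smul_apply, smul_eq_mul, Finset.mul_sum]
      refine Finset.sum_congr rfl fun _ _ => Finset.sum_congr rfl fun _ _ =>
        Finset.sum_congr rfl fun _ _ => ?_
      ring)

theorem sigmaPayoff_apply (g : (i : ι) → A1 i → A2 i → C → ℝ) (x : (Σ i, A1 i) → ℝ)
    (y : (i : ι) → C → A2 i → ℝ) :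
    sigmaPayoff g x y = ∑ i, ∑ a, x ⟨i, a⟩ * ∑ c, ∑ b, y i c b * g i a b c := by
  rw [sigmaPayoff, LinearMap.mk₂_apply, Fintype.sum_sigma]

/-- Player 1 can commit to one mixed action per battlefield, and Player 2 to weights in `Y`, such
that the minimum over battlefields has a saddle point. -/
theorem exists_saddle_of_min [Nonempty ι] [∀ i, Nonempty (A1 i)]
    (g : (i : ι) → A1 i → A2 i → C → ℝ) {Y : Set ((i : ι) → C → A2 i → ℝ)}
    (neY : Y.Nonempty) (cY : Convex ℝ Y) (kY : IsCompact Y) :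
    ∃ v : ℝ, ∃ δ : (i : ι) → A1 i → ℝ, (∀ i, δ i ∈ stdSimplex ℝ (A1 i)) ∧ ∃ y ∈ Y,
      (∀ z ∈ Y, ∃ i, ∑ a, δ i a * ∑ c, ∑ b, z i c b * g i a b c ≤ v) ∧
      ∀ d : (i : ι) → A1 i → ℝ, (∀ i, d i ∈ stdSimplex ℝ (A1 i)) →
        ∀ i, v ≤ ∑ a, d i a * ∑ c, ∑ b, y i c b * g i a b c := by
  classical
  obtain ⟨x, hx, y, hy, h⟩ := (sigmaPayoff g).exists_isSaddlePointOn
    ⟨_, single_mem_stdSimplex ℝ (⟨Classical.arbitrary ι, Classical.arbitrary _⟩ : Σ i, A1 i)⟩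
    (convex_stdSimplex ℝ _) (isCompact_stdSimplex ℝ _) neY cY kY
  choose δ hδ hxδ using fun i =>
    exists_mem_stdSimplex_eq_sum_mul (w := fun a : A1 i => x ⟨i, a⟩) fun a => hx.1 ⟨i, a⟩
  refine ⟨sigmaPayoff g x y, δ, hδ, y, hy, fun z hz => ?_, fun d hd i => ?_⟩
  · by_contra! hlt
    refine (h x hx z hz).not_gt ?_
    have hsum : ∑ i, ∑ a, x ⟨i, a⟩ = 1 := by rw [← hx.2, Fintype.sum_sigma]
    have hw (i : ι) : 0 ≤ ∑ a, x ⟨i, a⟩ := Finset.sum_nonneg fun a _ => hx.1 ⟨i, a⟩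
    obtain ⟨j, hj⟩ : ∃ j, 0 < ∑ a, x ⟨j, a⟩ := by
      by_contra! hle
      linarith [Finset.sum_nonpos fun i (_ : i ∈ Finset.univ) => hle i]
    calc sigmaPayoff g x y = ∑ i, (∑ a, x ⟨i, a⟩) * sigmaPayoff g x y := by
          rw [← Finset.sum_mul, hsum, one_mul]
      _ < ∑ i, (∑ a, x ⟨i, a⟩) * ∑ a, δ i a * ∑ c, ∑ b, z i c b * g i a b c :=
          Finset.sum_lt_sum (fun i _ => mul_le_mul_of_nonneg_left (hlt i).le (hw i))
            ⟨j, Finset.mem_univ j, mul_lt_mul_of_pos_left (hlt j) hj⟩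
      _ = sigmaPayoff g x z := by
          rw [sigmaPayoff_apply]
          refine Finset.sum_congr rfl fun i _ => ?_
          rw [Finset.mul_sum]
          refine Finset.sum_congr rfl fun a _ => ?_
          rw [← mul_assoc, ← hxδ i a]
  · let e : (Σ i, A1 i) → ℝ := fun p => if p.1 = i then d p.1 p.2 else 0
    have he : e ∈ stdSimplex ℝ (Σ i, A1 i) := by
      refine ⟨fun p => ?_, ?_⟩
      · dsimp only [e]
        split_ifs
        exacts [(hd p.1).1 p.2, le_rfl]
      · rw [Fintype.sum_sigma, Finset.sum_eq_single i (fun j _ hj => by simp [e, hj]) (by simp)]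
        simpa [e] using (hd i).2
    calc sigmaPayoff g x y ≤ sigmaPayoff g e y := h e he y hy
      _ = _ := by
          rw [sigmaPayoff_apply,
            Finset.sum_eq_single i (fun j _ hj => by simp [e, hj]) (by simp)]
          simp [e]

end MinAggregator

theorem Uosm_eq_inf'_occupation (n m : ℕ) (hn : 0 < n)
    (A1 A2 : Fin n → Type*) [∀ i, Fintype (A1 i)] [∀ i, Fintype (A2 i)]
    (u : (i : Fin n) → A1 i → A2 i → ℕ → ℝ) (δ1 : (i : Fin n) → A1 i → ℝ)
    (γ : {k : Fin n → Fin (m + 1) // ∑ i, (k i : ℕ) = m} → ℝ)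
    (δ2 : (i : Fin n) → Fin (m + 1) → A2 i → ℝ) :
    Uosm n m hn A1 A2 u δ1 γ δ2 = Finset.univ.inf' ⟨⟨0, hn⟩, Finset.mem_univ _⟩ fun i =>
      ∑ a, δ1 i a * ∑ c, ∑ b, occupation (fun i k => k.1 i) γ δ2 i c b * u i a b (c : ℕ) := by
  unfold Uosm
  congr 1
  ext i
  calc _ = ∑ k, ∑ a, δ1 i a * (γ k * ∑ b, δ2 i (k.1 i) b * u i a b (k.1 i : ℕ)) := by
        refine Finset.sum_congr rfl fun k _ => ?_
        simp only [Finset.mul_sum]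
        refine Finset.sum_congr rfl fun a _ => Finset.sum_congr rfl fun b _ => ?_
        ring
    _ = _ := by
        rw [Finset.sum_comm]
        refine Finset.sum_congr rfl fun a _ => ?_
        rw [← Finset.mul_sum]
        exact congrArg _ (sum_mul_eq_sum_occupation (fun i k => k.1 i) γ δ2 i
          fun c b => u i a b (c : ℕ))

theorem nonempty_soldierAssignment (n m : ℕ) (hn : 0 < n) :
    Nonempty {k : Fin n → Fin (m + 1) // ∑ i, (k i : ℕ) = m} := by
  refine ⟨⟨fun i => if i = ⟨0, hn⟩ then Fin.last m else 0, ?_⟩⟩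
  rw [Finset.sum_eq_single ⟨0, hn⟩ (fun j _ hj => by simp [hj]) (by simp)]
  simp

/-- in the one-sided discrete two-level Blotto game with min aggregator,
the minimax theorem holds and all optima are attained. -/
theorem stmt_6 (n : ℕ) (hn : 0 < n) (m : ℕ)
    (A1 A2 : Fin n → Type*) [∀ i, Fintype (A1 i)] [∀ i, Fintype (A2 i)]
    [∀ i, Nonempty (A1 i)] [∀ i, Nonempty (A2 i)]
    (u : (i : Fin n) → A1 i → A2 i → ℕ → ℝ) :
    ∃ v : ℝ,
      IsLeast {r : ℝ | ∃ δ1 : (i : Fin n) → A1 i → ℝ,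
        (∀ i, δ1 i ∈ stdSimplex ℝ (A1 i)) ∧
        IsGreatest {s : ℝ |
          ∃ γ ∈ stdSimplex ℝ {k : Fin n → Fin (m + 1) // ∑ i, (k i : ℕ) = m},
          ∃ δ2 : (i : Fin n) → Fin (m + 1) → A2 i → ℝ,
            (∀ i c, δ2 i c ∈ stdSimplex ℝ (A2 i)) ∧
            s = Uosm n m hn A1 A2 u δ1 γ δ2} r} v ∧
      IsGreatest {r : ℝ |
        ∃ γ ∈ stdSimplex ℝ {k : Fin n → Fin (m + 1) // ∑ i, (k i : ℕ) = m},
        ∃ δ2 : (i : Fin n) → Fin (m + 1) → A2 i → ℝ,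
          (∀ i c, δ2 i c ∈ stdSimplex ℝ (A2 i)) ∧
          IsLeast {s : ℝ | ∃ δ1 : (i : Fin n) → A1 i → ℝ,
            (∀ i, δ1 i ∈ stdSimplex ℝ (A1 i)) ∧
            s = Uosm n m hn A1 A2 u δ1 γ δ2} r} v := by
  have : Nonempty (Fin n) := ⟨⟨0, hn⟩⟩
  have := nonempty_soldierAssignment n m hn
  obtain ⟨v, δ, hδ, _, ⟨γ, hγ, ε, hε, rfl⟩, hle, hge⟩ :=
    exists_saddle_of_min (fun i a b (c : Fin (m + 1)) => u i a b c)
      (occupationSet_nonempty (A := A2)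
        fun i (k : {k : Fin n → Fin (m + 1) // ∑ i, (k i : ℕ) = m}) => k.1 i)
      (convex_occupationSet _) (isCompact_occupationSet _)
  have upper {γ'} (hγ' : γ' ∈ stdSimplex ℝ _) {ε' : (i : Fin n) → Fin (m + 1) → A2 i → ℝ}
      (hε' : ∀ i c, ε' i c ∈ stdSimplex ℝ (A2 i)) : Uosm n m hn A1 A2 u δ γ' ε' ≤ v := by
    obtain ⟨i, hi⟩ := hle _ ⟨γ', hγ', ε', hε', rfl⟩
    rw [Uosm_eq_inf'_occupation]
    exact (Finset.inf'_le _ (Finset.mem_univ i)).trans hi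
  have lower {d : (i : Fin n) → A1 i → ℝ} (hd : ∀ i, d i ∈ stdSimplex ℝ (A1 i)) :
      v ≤ Uosm n m hn A1 A2 u d γ ε := by
    rw [Uosm_eq_inf'_occupation]
    exact Finset.le_inf' _ _ fun i _ => hge d hd i
  have value : v = Uosm n m hn A1 A2 u δ γ ε := (lower hδ).antisymm (upper hγ hε)
  refine ⟨v, ⟨⟨δ, hδ, ⟨γ, hγ, ε, hε, value⟩, ?_⟩, ?_⟩, ⟨γ, hγ, ε, hε, ⟨δ, hδ, value⟩, ?_⟩, ?_⟩
  · rintro _ ⟨γ', hγ', ε', hε', rfl⟩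
    exact upper hγ' hε'
  · rintro r ⟨d, hd, hr⟩
    exact (lower hd).trans (hr.2 ⟨γ, hγ, ε, hε, rfl⟩)
  · rintro _ ⟨d, hd, rfl⟩
    exact lower hd
  · rintro r ⟨γ', hγ', ε', hε', hr⟩
    exact (hr.2 ⟨δ, hδ, rfl⟩).trans (upper hγ' hε')
end

section
/- In the one-sided discrete two-level Blotto game with min aggregator, a Nash equilibrium exists: there exist δ^{1*} (with δ^{1*}_i ∈ Δ(A_i^1)) and (γ*, δ^{2*}) (with γ* ∈ Δ(K²), δ^{2*}_{i,c} ∈ Δ(A_i^2)) such that U(δ^{1*}, γ, δ^2) ≤ U(δ^{1*}, γ*, δ^{2*}) ≤ U(δ^1, γ*, δ^{2*}) for all strategies δ^1 of Player 1 and (γ, δ^2) of Player 2, where U(δ^1,γ,δ^2) := min_{1≤i≤n} Σ_{k∈K²} γ(k) Σ_{α^1∈A_i^1} Σ_{α^2∈A_i^2} δ^1_i(α^1) δ^2_{i,k_i}(α^2) u_i(α^1,α^2,k_i). -/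
/-- Every nonnegative vector on a nonempty finite type is its total mass times a probability
vector. -/
lemma exists_stdSimplex_sum_mul_eq {J : Type*} [Fintype J] [Nonempty J] (x : J → ℝ)
    (hx : ∀ j, 0 ≤ x j) : ∃ p ∈ stdSimplex ℝ J, ∀ j, (∑ j', x j') * p j = x j := by
  classical
  by_cases h : ∑ j, x j = 0
  · refine ⟨Pi.single (Classical.arbitrary J) 1, single_mem_stdSimplex _ _, fun j => ?_⟩
    rw [h, zero_mul, (Finset.sum_eq_zero_iff_of_nonneg fun j _ => hx j).1 h j (Finset.mem_univ j)]
  · refine ⟨fun j => x j / ∑ j', x j', ⟨fun j => ?_, ?_⟩, fun j => ?_⟩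
    · exact div_nonneg (hx j) (Finset.sum_nonneg fun j _ => hx j)
    · rw [← Finset.sum_div, div_self h]
    · field_simp

/-- A bilinear zero-sum game between a simplex and a compact convex set of payoff vectors has a
saddle point. -/
lemma exists_saddle_stdSimplex {P : Type*} [Fintype P] [Nonempty P] {Y : Set (P → ℝ)}
    (hne : Y.Nonempty) (hconv : Convex ℝ Y) (hcomp : IsCompact Y) :
    ∃ a ∈ stdSimplex ℝ P, ∃ b ∈ Y, ∀ x ∈ stdSimplex ℝ P, ∀ y ∈ Y,
      ∑ p, a p * y p ≤ ∑ p, x p * b p := by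
  classical
  have hlin : ∀ y : P → ℝ, IsLinearMap ℝ fun x : P → ℝ => ∑ p, x p * y p := fun y =>
    ⟨fun _ _ => by simp [add_mul, Finset.sum_add_distrib],
      fun _ _ => by simp [Finset.mul_sum, mul_assoc]⟩
  have hlin' : ∀ x : P → ℝ, IsLinearMap ℝ fun y : P → ℝ => ∑ p, x p * y p := fun x =>
    ⟨fun _ _ => by simp [mul_add, Finset.sum_add_distrib],
      fun _ _ => by simp [Finset.mul_sum, mul_left_comm]⟩
  exact Sion.exists_isSaddlePointOn (f := fun x y : P → ℝ => ∑ p, x p * y p)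
    ⟨_, single_mem_stdSimplex ℝ (Classical.arbitrary P)⟩ (convex_stdSimplex ℝ P)
    (isCompact_stdSimplex ℝ P)
    (fun y _ => Continuous.lowerSemicontinuous (by fun_prop) |>.lowerSemicontinuousOn _)
    (fun y _ => ((hlin y).mk' _ |>.convexOn (convex_stdSimplex ℝ P)).quasiconvexOn)
    hconv hne hcomp
    (fun x _ => Continuous.upperSemicontinuous (by fun_prop) |>.upperSemicontinuousOn _)
    (fun x _ => ((hlin' x).mk' _ |>.concaveOn hconv).quasiconcaveOn)

/-- The expected payoffs of Player 2's strategy `(γ, δ2)` against each battlefield and action of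
Player 1. -/
noncomputable def payoffVector (n m : ℕ) (A1 A2 : Fin n → Type*) [∀ i, Fintype (A2 i)]
    (u : (i : Fin n) → A1 i → A2 i → ℕ → ℝ)
    (γ : {k : Fin n → Fin (m + 1) // ∑ i, (k i : ℕ) = m} → ℝ)
    (δ2 : (i : Fin n) → Fin (m + 1) → A2 i → ℝ) (p : Σ i, A1 i) : ℝ :=
  ∑ k : {k : Fin n → Fin (m + 1) // ∑ i, (k i : ℕ) = m},
    γ k * ∑ α2, δ2 p.1 (k.1 p.1) α2 * u p.1 p.2 α2 (k.1 p.1 : ℕ)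

/-- The payoff vectors attainable by Player 2. -/
def attainablePayoffs (n m : ℕ) (A1 A2 : Fin n → Type*) [∀ i, Fintype (A2 i)]
    (u : (i : Fin n) → A1 i → A2 i → ℕ → ℝ) : Set ((Σ i, A1 i) → ℝ) :=
  (fun s => payoffVector n m A1 A2 u s.1 s.2) ''
    (stdSimplex ℝ {k : Fin n → Fin (m + 1) // ∑ i, (k i : ℕ) = m} ×ˢ
      Set.univ.pi fun i => Set.univ.pi fun _ => stdSimplex ℝ (A2 i))

/-- The payoff vector depends on `γ` only through the marginals of the soldier counts. -/
lemma payoffVector_eq_sum_marginal (n m : ℕ) (A1 A2 : Fin n → Type*) [∀ i, Fintype (A2 i)]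
    (u : (i : Fin n) → A1 i → A2 i → ℕ → ℝ)
    (γ : {k : Fin n → Fin (m + 1) // ∑ i, (k i : ℕ) = m} → ℝ)
    (δ2 : (i : Fin n) → Fin (m + 1) → A2 i → ℝ) (p : Σ i, A1 i) :
    payoffVector n m A1 A2 u γ δ2 p =
      ∑ c, ∑ α2, ((∑ k with k.1 p.1 = c, γ k) * δ2 p.1 c α2) * u p.1 p.2 α2 (c : ℕ) := by
  rw [payoffVector, ← Finset.sum_fiberwise _ fun k => k.1 p.1]
  refine Finset.sum_congr rfl fun c _ => ?_
  simp_rw [mul_assoc, ← Finset.mul_sum, Finset.sum_mul]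
  refine Finset.sum_congr rfl fun k hk => ?_
  rw [(Finset.mem_filter.1 hk).2]

lemma isCompact_attainablePayoffs (n m : ℕ) (A1 A2 : Fin n → Type*) [∀ i, Fintype (A2 i)]
    (u : (i : Fin n) → A1 i → A2 i → ℕ → ℝ) : IsCompact (attainablePayoffs n m A1 A2 u) := by
  refine ((isCompact_stdSimplex ℝ _).prod (isCompact_univ_pi fun i =>
    isCompact_univ_pi fun _ => isCompact_stdSimplex ℝ (A2 i))).image ?_
  unfold payoffVector
  fun_prop

lemma nonempty_attainablePayoffs (n : ℕ) (hn : 0 < n) (m : ℕ) (A1 A2 : Fin n → Type*)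
    [∀ i, Fintype (A2 i)] [∀ i, Nonempty (A2 i)]
    (u : (i : Fin n) → A1 i → A2 i → ℕ → ℝ) : (attainablePayoffs n m A1 A2 u).Nonempty := by
  classical
  refine Set.Nonempty.image _ (Set.Nonempty.prod ?_ (Set.univ_pi_nonempty_iff.2 fun i =>
    Set.univ_pi_nonempty_iff.2 fun _ =>
      ⟨_, single_mem_stdSimplex ℝ (Classical.arbitrary (A2 i))⟩))
  refine ⟨_, single_mem_stdSimplex ℝ ⟨Pi.single ⟨0, hn⟩ (Fin.last m), ?_⟩⟩
  rw [Finset.sum_eq_single ⟨0, hn⟩] <;> simp +contextual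

lemma convex_attainablePayoffs (n m : ℕ) (A1 A2 : Fin n → Type*)
    [∀ i, Fintype (A2 i)] [∀ i, Nonempty (A2 i)]
    (u : (i : Fin n) → A1 i → A2 i → ℕ → ℝ) : Convex ℝ (attainablePayoffs n m A1 A2 u) := by
  rintro _ ⟨⟨γ, δ⟩, ⟨hγ, hδ⟩, rfl⟩ _ ⟨⟨γ', δ'⟩, ⟨hγ', hδ'⟩, rfl⟩ s t hs ht hst
  simp only [Set.mem_univ_pi] at hδ hδ'
  have key : ∀ i c, ∃ p ∈ stdSimplex ℝ (A2 i), ∀ α,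
      (∑ k with k.1 i = c, (s • γ + t • γ') k) * p α =
        s * ((∑ k with k.1 i = c, γ k) * δ i c α) +
          t * ((∑ k with k.1 i = c, γ' k) * δ' i c α) := by
    intro i c
    obtain ⟨p, hp, h⟩ := exists_stdSimplex_sum_mul_eq (fun α =>
        s * ((∑ k with k.1 i = c, γ k) * δ i c α) +
          t * ((∑ k with k.1 i = c, γ' k) * δ' i c α)) fun α =>
      add_nonneg
        (mul_nonneg hs (mul_nonneg (Finset.sum_nonneg fun k _ => hγ.1 k) ((hδ i c).1 α)))
        (mul_nonneg ht (mul_nonneg (Finset.sum_nonneg fun k _ => hγ'.1 k) ((hδ' i c).1 α)))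
    refine ⟨p, hp, fun α => ?_⟩
    rw [← h α]
    simp only [Finset.sum_add_distrib, ← Finset.mul_sum, (hδ i c).2, (hδ' i c).2, mul_one,
      Pi.add_apply, Pi.smul_apply, smul_eq_mul]
  choose δ'' hδ'' h using key
  refine ⟨(s • γ + t • γ', δ''), ⟨convex_stdSimplex ℝ _ hγ hγ' hs ht hst, ?_⟩, ?_⟩
  · simpa only [Set.mem_univ_pi] using hδ''
  · funext p
    simp only [Pi.add_apply, Pi.smul_apply, smul_eq_mul, payoffVector_eq_sum_marginal]
    simp only [Finset.mul_sum, ← Finset.sum_add_distrib]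
    refine Finset.sum_congr rfl fun c _ => Finset.sum_congr rfl fun α _ => ?_
    have := h p.1 c α
    simp only [Pi.add_apply, Pi.smul_apply, smul_eq_mul] at this
    rw [this]
    ring

/-- Against a fixed strategy of Player 2, the payoff is the minimum over the battlefields of the
averages of the payoff vector. -/
lemma Uosm_eq_inf'_payoffVector (n m : ℕ) (hn : 0 < n)
    (A1 A2 : Fin n → Type*) [∀ i, Fintype (A1 i)] [∀ i, Fintype (A2 i)]
    (u : (i : Fin n) → A1 i → A2 i → ℕ → ℝ) (δ1 : (i : Fin n) → A1 i → ℝ)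
    (γ : {k : Fin n → Fin (m + 1) // ∑ i, (k i : ℕ) = m} → ℝ)
    (δ2 : (i : Fin n) → Fin (m + 1) → A2 i → ℝ) :
    Uosm n m hn A1 A2 u δ1 γ δ2 = Finset.univ.inf' ⟨⟨0, hn⟩, Finset.mem_univ _⟩ fun i =>
      ∑ α1, δ1 i α1 * payoffVector n m A1 A2 u γ δ2 ⟨i, α1⟩ := by
  unfold Uosm payoffVector
  congr 1
  funext i
  simp only [Finset.mul_sum]
  rw [Finset.sum_comm]
  refine Finset.sum_congr rfl fun α1 _ => Finset.sum_congr rfl fun k _ =>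
    Finset.sum_congr rfl fun α2 _ => by ring

/-- the one-sided discrete two-level Blotto game with min aggregator
admits a Nash equilibrium (Player 1 minimizes, Player 2 maximizes). -/
theorem stmt_7 (n : ℕ) (hn : 0 < n) (m : ℕ)
    (A1 A2 : Fin n → Type*) [∀ i, Fintype (A1 i)] [∀ i, Fintype (A2 i)]
    [∀ i, Nonempty (A1 i)] [∀ i, Nonempty (A2 i)]
    (u : (i : Fin n) → A1 i → A2 i → ℕ → ℝ) :
    ∃ δ1s : (i : Fin n) → A1 i → ℝ,
    ∃ γs : {k : Fin n → Fin (m + 1) // ∑ i, (k i : ℕ) = m} → ℝ,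
    ∃ δ2s : (i : Fin n) → Fin (m + 1) → A2 i → ℝ,
      (∀ i, δ1s i ∈ stdSimplex ℝ (A1 i)) ∧
      γs ∈ stdSimplex ℝ {k : Fin n → Fin (m + 1) // ∑ i, (k i : ℕ) = m} ∧
      (∀ i c, δ2s i c ∈ stdSimplex ℝ (A2 i)) ∧
      ∀ δ1 : (i : Fin n) → A1 i → ℝ, (∀ i, δ1 i ∈ stdSimplex ℝ (A1 i)) →
      ∀ γ, γ ∈ stdSimplex ℝ {k : Fin n → Fin (m + 1) // ∑ i, (k i : ℕ) = m} →
      ∀ δ2 : (i : Fin n) → Fin (m + 1) → A2 i → ℝ,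
        (∀ i c, δ2 i c ∈ stdSimplex ℝ (A2 i)) →
        Uosm n m hn A1 A2 u δ1s γ δ2 ≤ Uosm n m hn A1 A2 u δ1s γs δ2s ∧
        Uosm n m hn A1 A2 u δ1s γs δ2s ≤ Uosm n m hn A1 A2 u δ1 γs δ2s := by
  classical
  have : Nonempty (Σ i, A1 i) := ⟨⟨⟨0, hn⟩, Classical.arbitrary _⟩⟩
  obtain ⟨x, hx, _, ⟨⟨γs, δ2s⟩, ⟨hγs, hδ2s⟩, rfl⟩, hsaddle⟩ := exists_saddle_stdSimplex
    (nonempty_attainablePayoffs n hn m A1 A2 u) (convex_attainablePayoffs n m A1 A2 u)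
    (isCompact_attainablePayoffs n m A1 A2 u)
  simp only [Set.mem_univ_pi] at hδ2s
  choose δ1s hδ1s hx_eq using fun i =>
    exists_stdSimplex_sum_mul_eq (fun α => x ⟨i, α⟩) fun α => hx.1 _
  set v := ∑ p, x p * payoffVector n m A1 A2 u γs δ2s p
  have lower : ∀ δ1 : (i : Fin n) → A1 i → ℝ, (∀ i, δ1 i ∈ stdSimplex ℝ (A1 i)) →
      v ≤ Uosm n m hn A1 A2 u δ1 γs δ2s := by
    intro δ1 hδ1
    rw [Uosm_eq_inf'_payoffVector]
    refine Finset.le_inf' _ _ fun i _ => ?_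
    have hpure : ∀ p, v ≤ payoffVector n m A1 A2 u γs δ2s p := fun p => by
      simpa [Pi.single_apply] using hsaddle _ (single_mem_stdSimplex ℝ p) _
        ⟨(γs, δ2s), ⟨hγs, by simpa only [Set.mem_univ_pi] using hδ2s⟩, rfl⟩
    calc v = ∑ α, δ1 i α * v := by rw [← Finset.sum_mul, (hδ1 i).2, one_mul]
      _ ≤ _ := Finset.sum_le_sum fun α _ => mul_le_mul_of_nonneg_left (hpure _) ((hδ1 i).1 α)
  have upper : ∀ γ, γ ∈ stdSimplex ℝ {k : Fin n → Fin (m + 1) // ∑ i, (k i : ℕ) = m} →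
      ∀ δ2 : (i : Fin n) → Fin (m + 1) → A2 i → ℝ, (∀ i c, δ2 i c ∈ stdSimplex ℝ (A2 i)) →
      Uosm n m hn A1 A2 u δ1s γ δ2 ≤ v := by
    intro γ hγ δ2 hδ2
    have hmass : ∑ i, ∑ α, x ⟨i, α⟩ = 1 := by rw [← Fintype.sum_sigma']; exact hx.2
    calc Uosm n m hn A1 A2 u δ1s γ δ2
        = ∑ i, (∑ α, x ⟨i, α⟩) * Uosm n m hn A1 A2 u δ1s γ δ2 := by
          rw [← Finset.sum_mul, hmass, one_mul]
      _ ≤ ∑ i, (∑ α, x ⟨i, α⟩) *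
            ∑ α, δ1s i α * payoffVector n m A1 A2 u γ δ2 ⟨i, α⟩ := by
          refine Finset.sum_le_sum fun i _ => mul_le_mul_of_nonneg_left ?_
            (Finset.sum_nonneg fun α _ => hx.1 _)
          rw [Uosm_eq_inf'_payoffVector]
          exact Finset.inf'_le _ (Finset.mem_univ i)
      _ = ∑ p, x p * payoffVector n m A1 A2 u γ δ2 p := by
          rw [Fintype.sum_sigma]
          refine Finset.sum_congr rfl fun i _ => ?_
          rw [Finset.mul_sum]
          refine Finset.sum_congr rfl fun α _ => ?_
          rw [← mul_assoc, hx_eq]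
      _ ≤ v := hsaddle x hx _ ⟨(γ, δ2), ⟨hγ, by simpa only [Set.mem_univ_pi] using hδ2⟩, rfl⟩
  exact ⟨δ1s, γs, δ2s, hδ1s, hγs, hδ2s, fun δ1 hδ1 γ hγ δ2 hδ2 =>
    ⟨(upper γ hγ δ2 hδ2).trans (lower δ1s hδ1s), (upper γs hγs δ2s hδ2s).trans (lower δ1 hδ1)⟩⟩
end

section
/- Define g : [0,2] × [0,1] → ℝ by g(a,b) = min( max(a − b, 0), max(1 − a + b, 0) ). Then sup_{a ∈ [0,2]} inf_{b ∈ [0,1]} g(a,b) = 0 while inf_{b ∈ [0,1]} sup_{a ∈ [0,2]} g(a,b) = 1/2. In particular the max-min and min-max values differ, so g has no saddle point on [0,2] × [0,1]. -/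
/-- Min-aggregated payoff of the two-sided continuous two-level Blotto counterexample:
Player 1 (maximizer) splits 2 soldiers as `(a, 2-a)`, Player 2 (minimizer) splits 1
soldier as `(b, 1-b)`, and each battlefield pays `max (σ¹ - σ², 0)`. -/
noncomputable def g9 (a b : ℝ) : ℝ := min (max (a - b) 0) (max (1 - a + b) 0)

theorem g9_nonneg (a b : ℝ) : 0 ≤ g9 a b :=
  le_min (le_max_right _ _) (le_max_right _ _)

theorem g9_le_half (a b : ℝ) : g9 a b ≤ 1 / 2 := by
  rcases le_total (a - b) (1 / 2) with h | h
  · exact (min_le_left _ _).trans (max_le h (by norm_num))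
  · exact (min_le_right _ _).trans (max_le (by linarith) (by norm_num))

/-- Player 1's best response to `b` is `b + 1/2`. -/
theorem g9_add_half (b : ℝ) : g9 (b + 1 / 2) b = 1 / 2 := by
  have h₁ : b + 1 / 2 - b = 1 / 2 := by ring
  have h₂ : 1 - (b + 1 / 2) + b = 1 / 2 := by ring
  rw [g9, h₁, h₂]
  norm_num

theorem add_half_mem_Icc {b : ℝ} (hb : b ∈ Set.Icc (0 : ℝ) 1) :
    b + 1 / 2 ∈ Set.Icc (0 : ℝ) 2 :=
  ⟨by linarith [hb.1], by linarith [hb.2]⟩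

/-- Player 2 can answer any `a` so as to hold Player 1 to zero. -/
theorem exists_g9_eq_zero {a : ℝ} (ha : a ∈ Set.Icc (0 : ℝ) 2) :
    ∃ b ∈ Set.Icc (0 : ℝ) 1, g9 a b = 0 := by
  rcases le_total a 1 with h | h
  · exact ⟨a, ⟨ha.1, h⟩, by simp [g9]⟩
  · refine ⟨0, by simp, le_antisymm ?_ (g9_nonneg _ _)⟩
    exact (min_le_right _ _).trans (max_le (by linarith) le_rfl)

theorem iInf_g9_eq_zero (a : Set.Icc (0 : ℝ) 2) :
    ⨅ b : Set.Icc (0 : ℝ) 1, g9 a b = 0 := by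
  obtain ⟨b, hb, h⟩ := exists_g9_eq_zero a.2
  refine le_antisymm ?_ (Real.iInf_nonneg fun b => g9_nonneg _ _)
  exact (ciInf_le ⟨0, by rintro _ ⟨b, rfl⟩; exact g9_nonneg _ _⟩
    (⟨b, hb⟩ : Set.Icc (0 : ℝ) 1)).trans h.le

theorem iSup_g9_eq_half (b : Set.Icc (0 : ℝ) 1) :
    ⨆ a : Set.Icc (0 : ℝ) 2, g9 a b = 1 / 2 := by
  refine le_antisymm (Real.iSup_le (fun a => g9_le_half _ _) (by norm_num)) ?_
  exact (g9_add_half b).ge.trans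
    (le_ciSup (f := fun a : Set.Icc (0 : ℝ) 2 => g9 a b)
      ⟨1 / 2, by rintro _ ⟨a, rfl⟩; exact g9_le_half _ _⟩ ⟨_, add_half_mem_Icc b.2⟩)

/-- the max-min value of `g9` on `[0,2] × [0,1]` is `0`, the min-max value
is `1/2`; in particular they differ and `g9` has no saddle point. -/
theorem stmt_9 :
    (⨆ a : Set.Icc (0:ℝ) 2, ⨅ b : Set.Icc (0:ℝ) 1, g9 a b) = 0 ∧
    (⨅ b : Set.Icc (0:ℝ) 1, ⨆ a : Set.Icc (0:ℝ) 2, g9 a b) = 1/2 ∧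
    ¬ ∃ as ∈ Set.Icc (0:ℝ) 2, ∃ bs ∈ Set.Icc (0:ℝ) 1,
        ∀ a ∈ Set.Icc (0:ℝ) 2, ∀ b ∈ Set.Icc (0:ℝ) 1,
          g9 a bs ≤ g9 as bs ∧ g9 as bs ≤ g9 as b := by
  refine ⟨?_, ?_, ?_⟩
  · simp only [iInf_g9_eq_zero, Real.iSup_const_zero]
  · simp only [iSup_g9_eq_half, ciInf_const]
  · rintro ⟨a, ha, b, hb, h⟩
    obtain ⟨b', hb', h₀⟩ := exists_g9_eq_zero ha
    have h₁ := (h _ (add_half_mem_Icc hb) b hb).1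
    have h₂ := (h a ha b' hb').2
    rw [g9_add_half] at h₁
    linarith
end

section
/- Define F : [0,2] × [0,1] × [0,1] → ℝ by F(σ,x,y) = x·(y·σ² + 2·(1−y)) + (2 − σ). Then max_{(σ,x) ∈ [0,2]×[0,1]} min_{y ∈ [0,1]} F(σ,x,y) = 4 − √2 (attained at σ = √2, x = 1), while min_{y ∈ [0,1]} max_{(σ,x) ∈ [0,2]×[0,1]} F(σ,x,y) = 3 (attained at y = 1/2). In particular the max-min and min-max values are both attained but do not coincide, so F has no saddle point. -/
/-- Sum-aggregated payoff of the one-sided continuous two-level Blotto counterexample: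
Player 1 (maximizer) allocates `σ ∈ [0,2]` to battlefield 1 and plays the top row with
probability `x`; Player 2 (minimizer) plays the left column with probability `y`. -/
noncomputable def F10 (σ x y : ℝ) : ℝ := x * (y * σ ^ 2 + 2 * (1 - y)) + (2 - σ)

open Set in
lemma F10_nonneg {σ x y : ℝ} (hσ : σ ∈ Icc (0:ℝ) 2) (hx : x ∈ Icc (0:ℝ) 1)
    (hy : y ∈ Icc (0:ℝ) 1) : 0 ≤ F10 σ x y := by
  have h₁ : 0 ≤ y * σ ^ 2 := mul_nonneg hy.1 (sq_nonneg σ)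
  have h₂ : 0 ≤ x * (y * σ ^ 2 + 2 * (1 - y)) := mul_nonneg hx.1 (by linarith [hy.2])
  unfold F10
  linarith [hσ.2]

open Set in
lemma F10_le_of_top_row {σ x y : ℝ} (hx : x ∈ Icc (0:ℝ) 1) (hy : y ∈ Icc (0:ℝ) 1) :
    F10 σ x y ≤ F10 σ 1 y := by
  have h₁ : 0 ≤ y * σ ^ 2 := mul_nonneg hy.1 (sq_nonneg σ)
  have h₂ : x * (y * σ ^ 2 + 2 * (1 - y)) ≤ 1 * (y * σ ^ 2 + 2 * (1 - y)) :=
    mul_le_mul_of_nonneg_right hx.2 (by linarith [hy.2])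
  unfold F10
  linarith

open Set in
lemma F10_le_six {σ x y : ℝ} (hσ : σ ∈ Icc (0:ℝ) 2) (hx : x ∈ Icc (0:ℝ) 1)
    (hy : y ∈ Icc (0:ℝ) 1) : F10 σ x y ≤ 6 := by
  refine (F10_le_of_top_row hx hy).trans ?_
  have h₁ : σ ^ 2 ≤ 4 := by nlinarith [hσ.1, hσ.2]
  have h₂ : y * σ ^ 2 ≤ y * 4 := mul_le_mul_of_nonneg_left h₁ hy.1
  unfold F10
  linarith [hσ.1, hy.2]

open Set in
/-- Player 2 can hold any allocation of Player 1 to at most `4 - √2`. -/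
lemma exists_F10_le {σ x : ℝ} (hσ : σ ∈ Icc (0:ℝ) 2) (hx : x ∈ Icc (0:ℝ) 1) :
    ∃ y ∈ Icc (0:ℝ) 1, F10 σ x y ≤ 4 - √2 := by
  have hs : √2 ^ 2 = 2 := Real.sq_sqrt (by norm_num)
  have hs₁ : 1 ≤ √2 := Real.one_le_sqrt.2 (by norm_num)
  rcases le_total σ √2 with h | h
  · refine ⟨1, by simp, (F10_le_of_top_row hx (by simp)).trans ?_⟩
    unfold F10
    nlinarith [mul_nonneg (sub_nonneg.2 h) (show 0 ≤ √2 + σ - 1 by linarith [hσ.1])]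
  · refine ⟨0, by simp, (F10_le_of_top_row hx (by simp)).trans ?_⟩
    unfold F10
    linarith

lemma F10_sqrt_two_one (y : ℝ) : F10 √2 1 y = 4 - √2 := by
  unfold F10
  rw [Real.sq_sqrt (by norm_num)]
  ring

open Set in
/-- Player 1 can secure at least `3` against any known strategy of Player 2. -/
lemma exists_le_F10 (y : ℝ) :
    ∃ σ ∈ Icc (0:ℝ) 2, ∃ x ∈ Icc (0:ℝ) 1, 3 ≤ F10 σ x y := by
  rcases le_total y (1 / 2) with h | h
  · exact ⟨0, by simp, 1, by simp, by unfold F10; linarith⟩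
  · exact ⟨2, by simp, 1, by simp, by unfold F10; linarith⟩

open Set in
lemma F10_half_le {σ x : ℝ} (hσ : σ ∈ Icc (0:ℝ) 2) (hx : x ∈ Icc (0:ℝ) 1) :
    F10 σ x (1 / 2) ≤ 3 := by
  refine (F10_le_of_top_row hx (by norm_num)).trans ?_
  unfold F10
  nlinarith [mul_nonneg hσ.1 (sub_nonneg.2 hσ.2)]

open Set in
lemma sInf_F10_sqrt_two :
    sInf {s : ℝ | ∃ y ∈ Icc (0:ℝ) 1, s = F10 √2 1 y} = 4 - √2 := by
  refine IsLeast.csInf_eq ⟨⟨0, by simp, (F10_sqrt_two_one 0).symm⟩, ?_⟩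
  rintro _ ⟨y, -, rfl⟩
  exact (F10_sqrt_two_one y).ge

open Set in
lemma sSup_F10_half :
    sSup {s : ℝ | ∃ σ ∈ Icc (0:ℝ) 2, ∃ x ∈ Icc (0:ℝ) 1, s = F10 σ x (1 / 2)} = 3 := by
  refine IsGreatest.csSup_eq ⟨⟨0, by simp, 1, by simp, by norm_num [F10]⟩, ?_⟩
  rintro _ ⟨σ, hσ, x, hx, rfl⟩
  exact F10_half_le hσ hx

/-- the max-min value of `F10` is `4 - √2`, attained at `σ = √2, x = 1`;
the min-max value is `3`, attained at `y = 1/2`; both are attained but differ, so `F10`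
has no saddle point. -/
theorem stmt_10 :
    IsGreatest {r : ℝ | ∃ σ ∈ Set.Icc (0:ℝ) 2, ∃ x ∈ Set.Icc (0:ℝ) 1,
        r = sInf {s : ℝ | ∃ y ∈ Set.Icc (0:ℝ) 1, s = F10 σ x y}} (4 - Real.sqrt 2) ∧
    sInf {s : ℝ | ∃ y ∈ Set.Icc (0:ℝ) 1, s = F10 (Real.sqrt 2) 1 y} = 4 - Real.sqrt 2 ∧
    IsLeast {r : ℝ | ∃ y ∈ Set.Icc (0:ℝ) 1,
        r = sSup {s : ℝ | ∃ σ ∈ Set.Icc (0:ℝ) 2, ∃ x ∈ Set.Icc (0:ℝ) 1,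
          s = F10 σ x y}} 3 ∧
    sSup {s : ℝ | ∃ σ ∈ Set.Icc (0:ℝ) 2, ∃ x ∈ Set.Icc (0:ℝ) 1,
        s = F10 σ x (1/2)} = 3 ∧
    ¬ ∃ σs ∈ Set.Icc (0:ℝ) 2, ∃ xs ∈ Set.Icc (0:ℝ) 1, ∃ ys ∈ Set.Icc (0:ℝ) 1,
        ∀ σ ∈ Set.Icc (0:ℝ) 2, ∀ x ∈ Set.Icc (0:ℝ) 1, ∀ y ∈ Set.Icc (0:ℝ) 1,
          F10 σ x ys ≤ F10 σs xs ys ∧ F10 σs xs ys ≤ F10 σs xs y := by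
  have hs₁ : 1 < √2 := Real.lt_sqrt_of_sq_lt (by norm_num)
  have hs₂ : √2 ≤ 2 := Real.sqrt_le_iff.2 (by norm_num)
  refine ⟨⟨⟨√2, ⟨by positivity, hs₂⟩, 1, by simp, sInf_F10_sqrt_two.symm⟩, ?_⟩,
    sInf_F10_sqrt_two, ⟨⟨1 / 2, by norm_num, sSup_F10_half.symm⟩, ?_⟩, sSup_F10_half, ?_⟩
  · rintro _ ⟨σ, hσ, x, hx, rfl⟩
    obtain ⟨y, hy, h⟩ := exists_F10_le hσ hx
    refine le_trans (csInf_le ⟨0, ?_⟩ ⟨y, hy, rfl⟩) h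
    rintro _ ⟨z, hz, rfl⟩
    exact F10_nonneg hσ hx hz
  · rintro _ ⟨y, hy, rfl⟩
    obtain ⟨σ, hσ, x, hx, h⟩ := exists_le_F10 y
    refine h.trans (le_csSup ⟨6, ?_⟩ ⟨σ, hσ, x, hx, rfl⟩)
    rintro _ ⟨τ, hτ, z, hz, rfl⟩
    exact F10_le_six hτ hz hy
  · rintro ⟨σs, hσs, xs, hxs, ys, -, h⟩
    obtain ⟨y, hy, h_le⟩ := exists_F10_le hσs hxs
    obtain ⟨σ, hσ, x, hx, h_ge⟩ := exists_le_F10 ys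
    have h_saddle := h σ hσ x hx y hy
    linarith [h_saddle.1, h_saddle.2]
end

section
/- Define U : [0,2] × [0,1] × [0,1] → ℝ by U(σ,x,y) = min( u₁(σ,x,y), 2 − σ ), where u₁(σ,x,y) = x·y if σ < 1 and u₁(σ,x,y) = σ²·(1−x)·(1−y) if σ ≥ 1. Then sup_{(σ,x) ∈ [0,2]×[0,1]} inf_{y ∈ [0,1]} U(σ,x,y) = 0, while inf_{y ∈ [0,1]} sup_{(σ,x) ∈ [0,2]×[0,1]} U(σ,x,y) ≥ 1/2. In particular the max-min and min-max values differ, so U has no saddle point; hence a one-sided continuous two-level Blotto game with min aggregator and discontinuous battlefield utilities may fail to admit a partially pure Nash equilibrium. -/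
/-- Min-aggregated payoff of the one-sided continuous two-level Blotto counterexample
with discontinuous battlefield utilities: battlefield 1 has expected utility
`x·y` if `σ < 1` and `σ²·(1-x)·(1-y)` if `σ ≥ 1`; battlefield 2 yields `2 - σ`. -/
noncomputable def U12 (σ x y : ℝ) : ℝ :=
  min (if σ < 1 then x * y else σ ^ 2 * (1 - x) * (1 - y)) (2 - σ)

theorem U12_nonneg {σ x y : ℝ} (hσ : σ ∈ Set.Icc (0:ℝ) 2) (hx : x ∈ Set.Icc (0:ℝ) 1)
    (hy : y ∈ Set.Icc (0:ℝ) 1) : 0 ≤ U12 σ x y := by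
  have hx' : 0 ≤ 1 - x := sub_nonneg.2 hx.2
  have hy' : 0 ≤ 1 - y := sub_nonneg.2 hy.2
  refine le_min ?_ (sub_nonneg.2 hσ.2)
  split_ifs
  · exact mul_nonneg hx.1 hy.1
  · positivity

theorem U12_le_two {σ : ℝ} (hσ : 0 ≤ σ) (x y : ℝ) : U12 σ x y ≤ 2 :=
  (min_le_right _ _).trans (by linarith)

theorem exists_U12_eq_zero {σ : ℝ} (hσ : σ ≤ 2) (x : ℝ) :
    ∃ y ∈ Set.Icc (0:ℝ) 1, U12 σ x y = 0 := by
  by_cases h : σ < 1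
  · exact ⟨0, by simp, by simp [U12, h, hσ]⟩
  · exact ⟨1, by simp, by simp [U12, h, hσ]⟩

theorem exists_half_le_U12 (y : ℝ) :
    ∃ σ ∈ Set.Icc (0:ℝ) 2, ∃ x ∈ Set.Icc (0:ℝ) 1, 1 / 2 ≤ U12 σ x y := by
  rcases le_total (1 / 2) y with h | h
  · refine ⟨0, by simp, 1, by simp, le_min ?_ (by norm_num)⟩
    simpa using h
  · refine ⟨1, by simp, 0, by simp, le_min ?_ (by norm_num)⟩
    norm_num
    linarith

theorem sInf_U12_eq_zero {σ x : ℝ} (hσ : σ ∈ Set.Icc (0:ℝ) 2) (hx : x ∈ Set.Icc (0:ℝ) 1) :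
    sInf {s : ℝ | ∃ y ∈ Set.Icc (0:ℝ) 1, s = U12 σ x y} = 0 := by
  obtain ⟨y, hy, h⟩ := exists_U12_eq_zero hσ.2 x
  refine IsLeast.csInf_eq ⟨⟨y, hy, h.symm⟩, ?_⟩
  rintro _ ⟨z, hz, rfl⟩
  exact U12_nonneg hσ hx hz

theorem half_le_sSup_U12 (y : ℝ) :
    1 / 2 ≤ sSup {s : ℝ | ∃ σ ∈ Set.Icc (0:ℝ) 2, ∃ x ∈ Set.Icc (0:ℝ) 1, s = U12 σ x y} := by
  obtain ⟨σ, hσ, x, hx, h⟩ := exists_half_le_U12 y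
  refine le_csSup_of_le ⟨2, ?_⟩ ⟨σ, hσ, x, hx, rfl⟩ h
  rintro _ ⟨τ, hτ, z, -, rfl⟩
  exact U12_le_two hτ.1 z y

/-- the max-min value of `U12` is `0` while the min-max value is at least
`1/2`; in particular they differ, so `U12` has no saddle point and this one-sided
continuous min-aggregated game with discontinuous utilities has no partially pure NE. -/
theorem stmt_12 :
    sSup {r : ℝ | ∃ σ ∈ Set.Icc (0:ℝ) 2, ∃ x ∈ Set.Icc (0:ℝ) 1,
        r = sInf {s : ℝ | ∃ y ∈ Set.Icc (0:ℝ) 1, s = U12 σ x y}} = 0 ∧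
    sInf {r : ℝ | ∃ y ∈ Set.Icc (0:ℝ) 1,
        r = sSup {s : ℝ | ∃ σ ∈ Set.Icc (0:ℝ) 2, ∃ x ∈ Set.Icc (0:ℝ) 1,
          s = U12 σ x y}} ≥ 1/2 ∧
    ¬ ∃ σs ∈ Set.Icc (0:ℝ) 2, ∃ xs ∈ Set.Icc (0:ℝ) 1, ∃ ys ∈ Set.Icc (0:ℝ) 1,
        ∀ σ ∈ Set.Icc (0:ℝ) 2, ∀ x ∈ Set.Icc (0:ℝ) 1, ∀ y ∈ Set.Icc (0:ℝ) 1,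
          U12 σ x ys ≤ U12 σs xs ys ∧ U12 σs xs ys ≤ U12 σs xs y := by
  refine ⟨IsGreatest.csSup_eq ⟨⟨0, by simp, 0, by simp, (sInf_U12_eq_zero (by simp) (by simp)).symm⟩, ?_⟩, ?_, ?_⟩
  · rintro _ ⟨σ, hσ, x, hx, rfl⟩
    exact (sInf_U12_eq_zero hσ hx).le
  · refine le_csInf ⟨_, 0, by simp, rfl⟩ ?_
    rintro _ ⟨y, -, rfl⟩
    exact half_le_sSup_U12 y
  · rintro ⟨σs, hσs, xs, hxs, ys, hys, h⟩
    obtain ⟨y, hy, hy0⟩ := exists_U12_eq_zero hσs.2 xs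
    obtain ⟨σ, hσ, x, hx, hhalf⟩ := exists_half_le_U12 ys
    have := h σ hσ x hx y hy
    linarith [this.1, this.2]
end

section
/- In the one-sided continuous two-level Blotto game with min aggregator, the max-min problem reduces to maximizing the minimum Nash value across battlefields: sup over (δ^2, σ) (with δ^2_i ∈ Δ(A_i^2), σ ∈ Σ_m) of inf over δ^1 (with δ^1_i ∈ Δ(A_i^1)) of min_{1≤i≤n} Σ_{α^1∈A_i^1} Σ_{α^2∈A_i^2} δ^1_i(α^1) δ^2_i(α^2) u_i(α^1,α^2,σ_i) equals sup_{σ ∈ Σ_m} min_{1≤i≤n} v_i*(σ_i). -/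
/-- The Nash value of battlefield `i` at allocation `s`:
`v_i*(s) = max_{δ²} min_{δ¹} E[u_i]`. -/
noncomputable def vstar (n : ℕ)
    (A1 A2 : Fin n → Type*) [∀ i, Fintype (A1 i)] [∀ i, Fintype (A2 i)]
    (u : (i : Fin n) → A1 i → A2 i → ℝ → ℝ) (i : Fin n) (s : ℝ) : ℝ :=
  sSup {r : ℝ | ∃ δ2 ∈ stdSimplex ℝ (A2 i),
    r = sInf {w : ℝ | ∃ δ1 ∈ stdSimplex ℝ (A1 i),
      w = ∑ α1 : A1 i, ∑ α2 : A2 i, δ1 α1 * δ2 α2 * u i α1 α2 s}}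

theorem csSup_eq_of_upperBounds_eq {S T : Set ℝ} (hS : S.Nonempty) (hT : T.Nonempty)
    (h : upperBounds S = upperBounds T) : sSup S = sSup T := by
  by_cases hb : BddAbove S
  · have hb' : BddAbove T := by rwa [BddAbove, ← h]
    have h1 : IsLeast (upperBounds S) (sSup S) := isLUB_csSup hS hb
    have h2 : IsLeast (upperBounds T) (sSup T) := isLUB_csSup hT hb'
    rw [h] at h1
    exact h1.unique h2
  · have hb' : ¬ BddAbove T := by rwa [BddAbove, ← h]
    rw [Real.sSup_of_not_bddAbove hb, Real.sSup_of_not_bddAbove hb']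

/-- The infimum over a product of a minimum of functions of separate coordinates is the minimum
of the infima. -/
theorem sInf_inf'_pi {ι : Type*} [Fintype ι] (hι : (Finset.univ : Finset ι).Nonempty)
    {X : ι → Type*} (D : (i : ι) → Set (X i)) (hD : ∀ i, (D i).Nonempty)
    (p : (i : ι) → X i → ℝ) (hp : ∀ i, BddBelow {w : ℝ | ∃ x ∈ D i, w = p i x}) :
    sInf {w : ℝ | ∃ x : (i : ι) → X i, (∀ i, x i ∈ D i) ∧
        w = Finset.univ.inf' hι fun i => p i (x i)} =
      Finset.univ.inf' hι fun i => sInf {w : ℝ | ∃ x ∈ D i, w = p i x} := by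
  classical
  choose x₀ hx₀ using hD
  have key : ∀ w ∈ {w : ℝ | ∃ x : (i : ι) → X i, (∀ i, x i ∈ D i) ∧
      w = Finset.univ.inf' hι fun i => p i (x i)},
      (Finset.univ.inf' hι fun i => sInf {w : ℝ | ∃ x ∈ D i, w = p i x}) ≤ w := by
    rintro w ⟨x, hx, rfl⟩
    exact Finset.inf'_mono_fun fun i _ => csInf_le (hp i) ⟨x i, hx i, rfl⟩
  apply le_antisymm
  · refine Finset.le_inf' _ _ fun i _ => le_csInf ⟨_, x₀ i, hx₀ i, rfl⟩ ?_
    rintro w ⟨y, hy, rfl⟩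
    have hmem : ∀ j, Function.update x₀ i y j ∈ D j := by
      intro j
      by_cases hj : j = i
      · subst hj; simpa using hy
      · simpa [Function.update_of_ne hj] using hx₀ j
    refine (csInf_le ⟨_, key⟩ ⟨Function.update x₀ i y, hmem, rfl⟩).trans ?_
    refine (Finset.inf'_le _ (Finset.mem_univ i)).trans ?_
    simp
  · exact le_csInf ⟨_, x₀, hx₀, rfl⟩ key

theorem abs_bilinear_stdSimplex_le {A B : Type*} [Fintype A] [Fintype B] (f : A → B → ℝ)
    {x : A → ℝ} {y : B → ℝ} (hx : x ∈ stdSimplex ℝ A) (hy : y ∈ stdSimplex ℝ B) :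
    |∑ a, ∑ b, x a * y b * f a b| ≤ ∑ a, ∑ b, |f a b| := by
  refine (Finset.abs_sum_le_sum_abs _ _).trans (Finset.sum_le_sum fun a _ => ?_)
  refine (Finset.abs_sum_le_sum_abs _ _).trans (Finset.sum_le_sum fun b _ => ?_)
  have hxa := mem_Icc_of_mem_stdSimplex hx a
  have hyb := mem_Icc_of_mem_stdSimplex hy b
  rw [abs_mul, abs_of_nonneg (mul_nonneg hxa.1 hyb.1)]
  exact mul_le_of_le_one_left (abs_nonneg _) (mul_le_one₀ hxa.2 hyb.1 hyb.2)

theorem stdSimplex_nonempty_of_nonempty (A : Type*) [Fintype A] [Nonempty A] :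
    (stdSimplex ℝ A).Nonempty := by
  classical
  exact ⟨_, single_mem_stdSimplex ℝ (Classical.arbitrary A)⟩

theorem bddBelow_bilinear_stdSimplex {A B : Type*} [Fintype A] [Fintype B] (f : A → B → ℝ)
    {y : B → ℝ} (hy : y ∈ stdSimplex ℝ B) :
    BddBelow {w : ℝ | ∃ x ∈ stdSimplex ℝ A, w = ∑ a, ∑ b, x a * y b * f a b} := by
  refine ⟨-∑ a, ∑ b, |f a b|, ?_⟩
  rintro w ⟨x, hx, rfl⟩
  exact (abs_le.1 (abs_bilinear_stdSimplex_le f hx hy)).1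

theorem bddAbove_maxmin_stdSimplex {A B : Type*} [Fintype A] [Fintype B] [Nonempty A]
    (f : A → B → ℝ) :
    BddAbove {r : ℝ | ∃ y ∈ stdSimplex ℝ B,
      r = sInf {w : ℝ | ∃ x ∈ stdSimplex ℝ A, w = ∑ a, ∑ b, x a * y b * f a b}} := by
  obtain ⟨x, hx⟩ := stdSimplex_nonempty_of_nonempty A
  refine ⟨∑ a, ∑ b, |f a b|, ?_⟩
  rintro r ⟨y, hy, rfl⟩
  exact (csInf_le (bddBelow_bilinear_stdSimplex f hy) ⟨x, hx, rfl⟩).trans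
    (abs_le.1 (abs_bilinear_stdSimplex_le f hx hy)).2

/-- in the one-sided continuous two-level Blotto game with min
aggregator, the max-min problem reduces to maximizing the minimum Nash value across
battlefields. -/
theorem stmt_14 (n : ℕ) (hn : 0 < n) (m : ℝ) (hm : 0 < m)
    (A1 A2 : Fin n → Type*) [∀ i, Fintype (A1 i)] [∀ i, Fintype (A2 i)]
    [∀ i, Nonempty (A1 i)] [∀ i, Nonempty (A2 i)]
    (u : (i : Fin n) → A1 i → A2 i → ℝ → ℝ) :
    sSup {r : ℝ | ∃ δ2 : (i : Fin n) → A2 i → ℝ,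
      (∀ i, δ2 i ∈ stdSimplex ℝ (A2 i)) ∧
      ∃ σ ∈ {σ : Fin n → ℝ | (∀ i, 0 ≤ σ i) ∧ ∑ i, σ i = m},
        r = sInf {w : ℝ | ∃ δ1 : (i : Fin n) → A1 i → ℝ,
          (∀ i, δ1 i ∈ stdSimplex ℝ (A1 i)) ∧
          w = Finset.univ.inf' ⟨⟨0, hn⟩, Finset.mem_univ _⟩ fun i =>
            ∑ α1 : A1 i, ∑ α2 : A2 i, δ1 i α1 * δ2 i α2 * u i α1 α2 (σ i)}} =
    sSup {r : ℝ | ∃ σ ∈ {σ : Fin n → ℝ | (∀ i, 0 ≤ σ i) ∧ ∑ i, σ i = m},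
      r = Finset.univ.inf' ⟨⟨0, hn⟩, Finset.mem_univ _⟩ fun i =>
        vstar n A1 A2 u i (σ i)} := by
  classical
  have hι : (Finset.univ : Finset (Fin n)).Nonempty := ⟨⟨0, hn⟩, Finset.mem_univ _⟩
  have inner : ∀ (δ2 : (i : Fin n) → A2 i → ℝ), (∀ i, δ2 i ∈ stdSimplex ℝ (A2 i)) →
      ∀ σ : Fin n → ℝ, _ := fun δ2 hδ2 σ =>
    sInf_inf'_pi hι (fun i => stdSimplex ℝ (A1 i))
      (fun i => stdSimplex_nonempty_of_nonempty (A1 i))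
      (fun i δ1 => ∑ α1 : A1 i, ∑ α2 : A2 i, δ1 α1 * δ2 i α2 * u i α1 α2 (σ i))
      (fun i => bddBelow_bilinear_stdSimplex (fun α1 α2 => u i α1 α2 (σ i)) (hδ2 i))
  choose y₀ hy₀ using fun i => stdSimplex_nonempty_of_nonempty (A2 i)
  have hσ₀ : (Pi.single ⟨0, hn⟩ m : Fin n → ℝ) ∈
      {σ : Fin n → ℝ | (∀ i, 0 ≤ σ i) ∧ ∑ i, σ i = m} := by
    refine ⟨fun i => ?_, by simp⟩
    exact (Pi.single_nonneg.2 hm.le : (0 : Fin n → ℝ) ≤ Pi.single ⟨0, hn⟩ m) i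
  refine csSup_eq_of_upperBounds_eq ⟨_, y₀, hy₀, _, hσ₀, rfl⟩ ⟨_, _, hσ₀, rfl⟩ ?_
  ext b
  constructor
  · rintro hb _ ⟨σ, hσ, rfl⟩
    refine le_of_forall_pos_sub_le fun ε hε => ?_
    have hex : ∀ i, ∃ y ∈ stdSimplex ℝ (A2 i), vstar n A1 A2 u i (σ i) - ε <
        sInf {w : ℝ | ∃ δ1 ∈ stdSimplex ℝ (A1 i),
          w = ∑ α1 : A1 i, ∑ α2 : A2 i, δ1 α1 * y α2 * u i α1 α2 (σ i)} := by
      intro i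
      obtain ⟨_, ⟨y, hy, rfl⟩, h⟩ := exists_lt_of_lt_csSup
        (s := {r : ℝ | ∃ δ2 ∈ stdSimplex ℝ (A2 i),
          r = sInf {w : ℝ | ∃ δ1 ∈ stdSimplex ℝ (A1 i),
            w = ∑ α1 : A1 i, ∑ α2 : A2 i, δ1 α1 * δ2 α2 * u i α1 α2 (σ i)}})
        ⟨_, y₀ i, hy₀ i, rfl⟩ (sub_lt_self (vstar n A1 A2 u i (σ i)) hε)
      exact ⟨y, hy, h⟩
    choose y hy h using hex
    refine le_trans ?_ (hb ⟨y, hy, σ, hσ, (inner y hy σ).symm⟩)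
    refine Finset.le_inf' _ _ fun i _ => le_trans ?_ (h i).le
    exact sub_le_sub_right (Finset.inf'_le _ (Finset.mem_univ i)) ε
  · rintro hb _ ⟨δ2, hδ2, σ, hσ, rfl⟩
    refine le_trans ?_ (hb ⟨σ, hσ, rfl⟩)
    refine (inner δ2 hδ2 σ).le.trans (Finset.inf'_mono_fun fun i _ => ?_)
    exact le_csSup (bddAbove_maxmin_stdSimplex fun α1 α2 => u i α1 α2 (σ i))
      ⟨δ2 i, hδ2 i, rfl⟩
end

section
/- Let n ≥ 1, m > 0, and let c_i > 0 and d_i ∈ ℝ for i = 1,…,n. Define V : ℝ^n → ℝ by V(σ) := min_{1≤i≤n} (c_i σ_i + d_i), and let Σ_m := {σ ∈ ℝ^n : σ_i ≥ 0, Σ_{i=1}^n σ_i = m}. Suppose σ* is the unique maximizer of V over Σ_m. Then V satisfies the weak sharp-maxima condition with exponent p = 1: there exists ε > 0 such that V(σ*) − V(σ) ≥ ε · ‖σ − σ*‖_∞ for all σ ∈ Σ_m. -/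
/-- Around a point `x` with the same coordinate sum as `y`, some coordinate of `y` falls below that
of `x` by at least the average of any single deviation. -/
lemma exists_abs_sub_le_card_mul_sub {n : ℕ} {x y : Fin n → ℝ} (hxy : ∑ i, y i = ∑ i, x i)
    (i : Fin n) : ∃ j, |y i - x i| ≤ n * (x j - y j) := by
  by_contra! h
  have hn : (1 : ℝ) ≤ n := by exact_mod_cast i.pos
  have hs : ∑ k, (n * (y k - x k) + |y i - x i|) = n * |y i - x i| := by
    simp [Finset.sum_add_distrib, ← Finset.mul_sum, hxy]
  have hle := Finset.single_le_sum (f := fun k => n * (y k - x k) + |y i - x i|)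
    (fun k _ => by linarith [h k]) (Finset.mem_univ i)
  simp only [hs] at hle
  have hi := h i
  rcases le_total 0 (y i - x i) with h0 | h0
  · rw [abs_of_nonneg h0] at hle hi
    nlinarith
  · rw [abs_of_nonpos h0] at hi
    nlinarith

/-- If `σs` is the strict maximizer of `min_i (c_i σ_i + d_i)` over the simplex, then every
coordinate from which mass can be moved elsewhere attains the minimum at `σs`. -/
lemma le_inf'_of_strict_max {n : ℕ} (hne : (Finset.univ : Finset (Fin n)).Nonempty) {m : ℝ}
    {c d σs : Fin n → ℝ} (hc : ∀ i, 0 < c i) (hnonneg : ∀ i, 0 ≤ σs i) (hsum : ∑ i, σs i = m)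
    (hmax : ∀ σ : Fin n → ℝ, (∀ i, 0 ≤ σ i) → ∑ i, σ i = m → σ ≠ σs →
      (Finset.univ.inf' hne fun i => c i * σ i + d i) <
      (Finset.univ.inf' hne fun i => c i * σs i + d i))
    {i j : Fin n} (hij : i ≠ j) (hi : 0 < σs i) :
    c i * σs i + d i ≤ Finset.univ.inf' hne fun i => c i * σs i + d i := by
  by_contra! hlt
  set v := Finset.univ.inf' hne fun i => c i * σs i + d i with hv
  obtain ⟨η, hη, hη₁, hη₂⟩ : ∃ η > 0, η ≤ σs i ∧ c i * η ≤ c i * σs i + d i - v := by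
    refine ⟨min (σs i) ((c i * σs i + d i - v) / c i),
      lt_min hi (div_pos (by linarith) (hc i)), min_le_left _ _, ?_⟩
    rw [mul_comm, ← le_div_iff₀ (hc i)]
    exact min_le_right _ _
  let τ : Fin n → ℝ := σs + (Pi.single j η - Pi.single i η)
  have hτi : τ i = σs i - η := by simp [τ, hij]; ring
  have hτ : ∀ k, k ≠ i → σs k ≤ τ k := by
    intro k hk
    have : (0 : ℝ) ≤ (Pi.single j η : Fin n → ℝ) k := by
      rw [Pi.single_apply]
      split_ifs <;> linarith
    simp [τ, hk, this]
  refine (hmax τ (fun k => ?_) ?_ fun h => ?_).not_ge ?_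
  · by_cases hk : k = i
    · subst hk; linarith
    · exact (hnonneg k).trans (hτ k hk)
  · simp [τ, Finset.sum_add_distrib, hsum]
  · have := congrFun h i
    linarith
  · refine Finset.le_inf' _ _ fun k hk' => ?_
    by_cases hk : k = i
    · subst hk
      rw [hτi]; linarith
    · have h₁ : v ≤ c k * σs k + d k := Finset.inf'_le _ hk'
      have h₂ := mul_le_mul_of_nonneg_left (hτ k hk) (hc k).le
      linarith


/-- for affine battlefield utilities `u_i(σ) = c_i σ_i + d_i` with
`c_i > 0`, the aggregate value `V(σ) = min_i (c_i σ_i + d_i)` satisfies the weak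
sharp-maxima condition with exponent `p = 1` around its unique maximizer `σ*` over
the simplex `Σ_m`, with the sup-norm. -/
theorem stmt_17 (n : ℕ) (hn : 0 < n) (m : ℝ) (hm : 0 < m)
    (c d : Fin n → ℝ) (hc : ∀ i, 0 < c i)
    (σs : Fin n → ℝ)
    (hmem : σs ∈ {σ : Fin n → ℝ | (∀ i, 0 ≤ σ i) ∧ ∑ i, σ i = m})
    (hmax : ∀ σ ∈ {σ : Fin n → ℝ | (∀ i, 0 ≤ σ i) ∧ ∑ i, σ i = m}, σ ≠ σs →
      (Finset.univ.inf' ⟨⟨0, hn⟩, Finset.mem_univ _⟩ fun i => c i * σ i + d i) <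
      (Finset.univ.inf' ⟨⟨0, hn⟩, Finset.mem_univ _⟩ fun i => c i * σs i + d i)) :
    ∃ ε > (0:ℝ), ∀ σ ∈ {σ : Fin n → ℝ | (∀ i, 0 ≤ σ i) ∧ ∑ i, σ i = m},
      ε * (Finset.univ.sup' ⟨⟨0, hn⟩, Finset.mem_univ _⟩ fun i => |σ i - σs i|) ≤
      (Finset.univ.inf' ⟨⟨0, hn⟩, Finset.mem_univ _⟩ fun i => c i * σs i + d i) -
      (Finset.univ.inf' ⟨⟨0, hn⟩, Finset.mem_univ _⟩ fun i => c i * σ i + d i) := by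
  have hne : (Finset.univ : Finset (Fin n)).Nonempty := ⟨⟨0, hn⟩, Finset.mem_univ _⟩
  have hn' : (0 : ℝ) < n := by exact_mod_cast hn
  obtain ⟨i₀, -, hmin⟩ := Finset.exists_min_image Finset.univ c hne
  refine ⟨c i₀ / n, div_pos (hc i₀) hn', fun σ hσ => ?_⟩
  by_cases hσs : σ = σs
  · subst hσs
    simp only [sub_self, abs_zero]
    exact (mul_eq_zero_of_right _ (Finset.sup'_const hne 0)).le
  have hgap := hmax σ hσ hσs
  obtain ⟨i, -, hi⟩ := Finset.exists_mem_eq_sup' hne fun i => |σ i - σs i|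
  rw [hi]
  have hsum : ∑ k, σ k = ∑ k, σs k := hσ.2.trans hmem.2.symm
  obtain ⟨j, hj⟩ := exists_abs_sub_le_card_mul_sub hsum i
  have hbound : c i₀ / n * |σ i - σs i| ≤ c i₀ * (σs j - σ j) := by
    rw [div_mul_eq_mul_div, div_le_iff₀ hn']
    nlinarith [mul_le_mul_of_nonneg_left hj (hc i₀).le]
  refine hbound.trans ?_
  rcases le_or_gt (σs j) (σ j) with hle | hlt
  · nlinarith [hc i₀]
  obtain ⟨k, hk⟩ : ∃ k, σs k < σ k := by
    by_contra! h
    exact (Finset.sum_lt_sum (fun k _ => h k) ⟨j, Finset.mem_univ j, hlt⟩).ne hsum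
  have hjk : j ≠ k := by
    rintro rfl
    exact lt_asymm hlt hk
  have hact := le_inf'_of_strict_max hne hc hmem.1 hmem.2
    (fun τ h₁ h₂ => hmax τ ⟨h₁, h₂⟩) hjk ((hσ.1 j).trans_lt hlt)
  have hle : (Finset.univ.inf' hne fun i => c i * σ i + d i) ≤ c j * σ j + d j :=
    Finset.inf'_le _ (Finset.mem_univ j)
  have := mul_le_mul_of_nonneg_right (hmin j (Finset.mem_univ j)) (sub_nonneg.2 hlt.le)
  linarith
end
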